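/- arXiv:1612.02988 — 4 statements merged into one kernel-verified Lean document; each statement's English description precedes it below -/
import Mathlib

section
/- Let G be a finite connected bipartite vertex-transitive graph with at least 6 vertices. Then G is 2-extendable if and only if G is not isomorphic to a cycle graph. -/
open SimpleGraph

/-- A simple graph is vertex-transitive if any vertex can be mapped to any other
by a graph automorphism. -/
def IsVertexTransitive {V : Type*} (G : SimpleGraph V) : Prop :=
  ∀ x y : V, ∃ φ : G ≃g G, φ x = y

/-- A graph `G` with at least `2*n+2` vertices is `n`-extendable if it has a matching
of size `n` and every matching of size `n` extends to a perfect matching. -/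
def IsNExtendable {V : Type*} [Fintype V] (G : SimpleGraph V) (n : ℕ) : Prop :=
  2 * n + 2 ≤ Fintype.card V ∧
    (∃ M : G.Subgraph, M.IsMatching ∧ M.edgeSet.ncard = n) ∧
    ∀ M : G.Subgraph, M.IsMatching → M.edgeSet.ncard = n →
      ∃ P : G.Subgraph, P.IsPerfectMatching ∧ M.edgeSet ⊆ P.edgeSet

/-- Neighbourhood of a set. -/
noncomputable def nbS {V : Type*} [Fintype V] (G : SimpleGraph V) (X : Finset V) : Finset V := by
  classical exact Finset.univ.filter (fun v => ∃ x ∈ X, G.Adj x v)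

section aux
variable {V : Type*} [Fintype V] {G : SimpleGraph V}

lemma mem_nbS {X : Finset V} {v : V} : v ∈ nbS G X ↔ ∃ x ∈ X, G.Adj x v := by
  simp [nbS]

lemma nbS_mono {X Y : Finset V} (h : X ⊆ Y) : nbS G X ⊆ nbS G Y := by
  intro v hv
  rw [mem_nbS] at hv ⊢
  obtain ⟨x, hx, h'⟩ := hv
  exact ⟨x, h hx, h'⟩

lemma closed_univ (hconn : G.Connected) {X : Finset V} (hne : X.Nonempty)
    (h : nbS G X ⊆ X) : ∀ v, v ∈ X := by
  obtain ⟨x, hx⟩ := hne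
  intro v
  obtain ⟨p⟩ := hconn.preconnected x v
  induction p with
  | nil => exact hx
  | cons hadj p ih => exact ih (h (mem_nbS.2 ⟨_, hx, hadj⟩))

lemma nb_count [DecidableEq V] [DecidableRel G.Adj] {k : ℕ} (hreg : ∀ v, G.degree v = k) (X : Finset V) :
    k * X.card = ∑ b ∈ nbS G X, (G.neighborFinset b ∩ X).card := by
  have h := Finset.sum_card_bipartiteAbove_eq_sum_card_bipartiteBelow (s := X) (t := nbS G X)
    (fun a b => G.Adj a b)
  have h1 : ∀ a ∈ X, ((nbS G X).bipartiteAbove (fun a b => G.Adj a b) a).card = k := by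
    intro a ha
    rw [← hreg a, ← G.card_neighborFinset_eq_degree]
    congr 1
    ext b
    simp only [Finset.mem_bipartiteAbove, mem_neighborFinset, mem_nbS]
    exact ⟨fun h => h.2, fun h => ⟨⟨a, ha, h⟩, h⟩⟩
  rw [Finset.sum_congr rfl h1] at h
  simp only [Finset.sum_const, smul_eq_mul] at h
  rw [mul_comm, h]
  refine Finset.sum_congr rfl fun b _ => ?_
  congr 1
  ext a
  simp [Finset.mem_bipartiteBelow, G.adj_comm a b, and_comm]

lemma nb_ge [DecidableEq V] [DecidableRel G.Adj] {k : ℕ} (hk : 0 < k)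
    (hreg : ∀ v, G.degree v = k) (X : Finset V) : X.card ≤ (nbS G X).card := by
  have h := nb_count hreg X
  have h2 : ∑ b ∈ nbS G X, (G.neighborFinset b ∩ X).card ≤ ∑ b ∈ nbS G X, k := by
    refine Finset.sum_le_sum fun b _ => ?_
    rw [← hreg b, ← G.card_neighborFinset_eq_degree]
    exact Finset.card_le_card Finset.inter_subset_left
  rw [← h] at h2
  simp only [Finset.sum_const, smul_eq_mul] at h2
  rw [mul_comm] at h2
  exact Nat.le_of_mul_le_mul_right h2 hk

lemma nb_tight [DecidableEq V] [DecidableRel G.Adj] {k : ℕ}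
    (hreg : ∀ v, G.degree v = k) (hconn : G.Connected) (X : Finset V) (hne : X.Nonempty)
    (hle : (nbS G X).card ≤ X.card) : ∀ v, v ∈ X ∪ nbS G X := by
  have h := nb_count hreg X
  have h2 : ∀ b ∈ nbS G X, (G.neighborFinset b ∩ X).card ≤ k := by
    intro b _
    rw [← hreg b, ← G.card_neighborFinset_eq_degree]
    exact Finset.card_le_card Finset.inter_subset_left
  have h3 : ∑ b ∈ nbS G X, (G.neighborFinset b ∩ X).card = ∑ b ∈ nbS G X, k := by
    refine le_antisymm (Finset.sum_le_sum h2) ?_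
    rw [← h]
    simp only [Finset.sum_const, smul_eq_mul]
    rw [mul_comm]
    exact Nat.mul_le_mul_left _ hle
  rw [Finset.sum_eq_sum_iff_of_le h2] at h3
  refine closed_univ hconn (hne.mono Finset.subset_union_left) ?_
  intro v hv
  rw [mem_nbS] at hv
  obtain ⟨x, hx, hxv⟩ := hv
  rw [Finset.mem_union] at hx ⊢
  rcases hx with hx | hx
  · exact Or.inr (mem_nbS.2 ⟨x, hx, hxv⟩)
  · left
    have h4 := h3 x hx
    rw [← hreg x, ← G.card_neighborFinset_eq_degree] at h4
    have h5 := Finset.eq_of_subset_of_card_le Finset.inter_subset_left h4.ge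
    have : v ∈ G.neighborFinset x ∩ X := by rw [h5]; simpa using hxv
    exact (Finset.mem_inter.1 this).2

lemma col_iso (hconn : G.Connected) (c : G.Coloring Bool) (φ : G ≃g G) {x y : V} (h : c x = c y) :
    c (φ x) = c (φ y) := by
  obtain ⟨p⟩ := hconn.preconnected x y
  have h1 := c.even_length_iff_congr p
  have h2 := c.even_length_iff_congr (p.map φ.toHom)
  rw [Walk.length_map, h1] at h2
  rw [Bool.eq_iff_iff] at h ⊢
  exact h2.1 h

/-- colour class -/
noncomputable def side (c : G.Coloring Bool) (b : Bool) : Finset V := Finset.univ.filter (fun v => c v = b)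

lemma mem_side {c : G.Coloring Bool} {b : Bool} {v : V} : v ∈ side c b ↔ c v = b := by simp [side]

lemma nbS_side {c : G.Coloring Bool} {b : Bool} {X : Finset V} (h : X ⊆ side c b) :
    nbS G X ⊆ side c (!b) := by
  intro v hv
  obtain ⟨x, hx, hxv⟩ := mem_nbS.1 hv
  have h1 := mem_side.1 (h hx)
  have h2 := c.valid hxv
  rw [mem_side]
  rw [h1] at h2
  cases b <;> simp_all

lemma side_card [DecidableEq V] [DecidableRel G.Adj] {k : ℕ} (hk : 0 < k)
    (hreg : ∀ v, G.degree v = k) (c : G.Coloring Bool) (b : Bool) :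
    (side c b).card = (side c true).card := by
  have key : ∀ b, (side c b).card ≤ (side c (!b)).card := fun b =>
    (nb_ge hk hreg _).trans (Finset.card_le_card (nbS_side subset_rfl))
  cases b
  · exact le_antisymm (key false) (key true)
  · rfl

lemma side_total [DecidableEq V] [DecidableRel G.Adj] {k : ℕ} (hk : 0 < k)
    (hreg : ∀ v, G.degree v = k) (c : G.Coloring Bool) :
    2 * (side c true).card = Fintype.card V := by
  have h := Finset.card_filter_add_card_filter_not (s := (Finset.univ : Finset V)) (fun v => c v = true)
  have h1 := side_card hk hreg c false
  have : side c false = Finset.univ.filter (fun v => ¬ c v = true) := by ext; simp [side]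
  rw [this] at h1
  rw [h1] at h
  rw [← Finset.card_univ, ← h]
  simp only [side]
  omega

lemma nb_strict [DecidableEq V] [DecidableRel G.Adj] {k : ℕ}
    (hreg : ∀ v, G.degree v = k) (hconn : G.Connected) (c : G.Coloring Bool) {b : Bool}
    {X : Finset V} (hX : X ⊆ side c b) (hne : X.Nonempty) (hlt : X.card < (side c b).card) :
    X.card + 1 ≤ (nbS G X).card := by
  by_contra hcon
  have h := nb_tight hreg hconn X hne (by omega)
  have : side c b ⊆ X := by
    intro v hv
    rcases Finset.mem_union.1 (h v) with h | h
    · exact h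
    · have := mem_side.1 (nbS_side hX h)
      rw [mem_side.1 hv] at this
      simp at this
  exact absurd (Finset.card_le_card this) (by omega)

structure Bad (c : G.Coloring Bool) (X : Finset V) (b : Bool) : Prop where
  sub : X ⊆ side c b
  ne : X.Nonempty
  sm : X.card + 2 ≤ (side c true).card
  nb : (nbS G X).card ≤ X.card + 1

lemma Bad.nb_eq [DecidableEq V] [DecidableRel G.Adj] {k : ℕ} (hk : 0 < k)
    (hreg : ∀ v, G.degree v = k) (hconn : G.Connected) {c : G.Coloring Bool} {b : Bool}
    {X : Finset V} (h : Bad c X b) : (nbS G X).card = X.card + 1 := by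
  refine le_antisymm h.nb (nb_strict hreg hconn c h.sub h.ne ?_)
  rw [side_card hk hreg]
  have := h.sm
  omega

lemma Bad.dual [DecidableEq V] [DecidableRel G.Adj] {k : ℕ} (hk : 0 < k)
    (hreg : ∀ v, G.degree v = k) (hconn : G.Connected) {c : G.Coloring Bool} {b : Bool}
    {X : Finset V} (h : Bad c X b) : Bad c (side c (!b) \ nbS G X) (!b) ∧
      (side c (!b) \ nbS G X).card + X.card + 1 = (side c true).card := by
  have h1 := h.nb_eq hk hreg hconn
  have h2 := Finset.card_sdiff_add_card_eq_card (nbS_side h.sub)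
  have h3 := Finset.card_sdiff_add_card_eq_card h.sub
  have h4 := h.sm
  have h5 := h.ne.card_pos
  rw [side_card hk hreg] at h2 h3
  refine ⟨⟨Finset.sdiff_subset, ?_, by omega, ?_⟩, by omega⟩
  · rw [← Finset.card_pos]; omega
  · have : nbS G (side c (!b) \ nbS G X) ⊆ side c b \ X := by
      intro v hv
      rw [Finset.mem_sdiff]
      refine ⟨by simpa using nbS_side (Finset.sdiff_subset (s := side c (!b)) (t := nbS G X)) hv, ?_⟩
      intro hvX
      obtain ⟨x, hx, hxv⟩ := mem_nbS.1 hv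
      exact (Finset.mem_sdiff.1 hx).2 (mem_nbS.2 ⟨v, hvX, hxv.symm⟩)
    have := Finset.card_le_card this
    omega

lemma Bad.move (hconn : G.Connected) (hvt : IsVertexTransitive G) {c : G.Coloring Bool} {b : Bool}
    {X : Finset V} (h : Bad c X b) (v : V) :
    ∃ Y, Bad c Y (c v) ∧ v ∈ Y ∧ Y.card = X.card := by
  obtain ⟨x, hx⟩ := h.ne
  obtain ⟨φ, hφ⟩ := hvt x v
  have hn : nbS G (X.map φ.toEquiv.toEmbedding) = (nbS G X).map φ.toEquiv.toEmbedding := by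
    ext w
    simp only [mem_nbS, Finset.mem_map]
    constructor
    · rintro ⟨_, ⟨y, hy, rfl⟩, hw⟩
      refine ⟨φ.symm w, ⟨y, hy, ?_⟩, by simp⟩
      rw [← φ.map_adj_iff]
      simpa using hw
    · rintro ⟨u, ⟨y, hy, hu⟩, rfl⟩
      exact ⟨_, ⟨y, hy, rfl⟩, φ.map_adj_iff.2 hu⟩
  refine ⟨X.map φ.toEquiv.toEmbedding, ⟨?_, ?_, ?_, ?_⟩, ?_, by simp⟩
  · intro w hw
    obtain ⟨y, hy, rfl⟩ := Finset.mem_map.1 hw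
    rw [mem_side, ← hφ]
    refine col_iso hconn c φ ?_
    rw [mem_side.1 (h.sub hy), mem_side.1 (h.sub hx)]
  · simpa using h.ne
  · simpa using h.sm
  · rw [hn]; simpa using h.nb
  · exact Finset.mem_map.2 ⟨x, hx, hφ⟩

lemma Bad.uncross [DecidableEq V] [DecidableRel G.Adj] {k : ℕ} (hk : 0 < k)
    (hreg : ∀ v, G.degree v = k) (hconn : G.Connected) {c : G.Coloring Bool} {b : Bool}
    {X Y : Finset V} (hX : Bad c X b) (hY : Bad c Y b) (hne : (X ∩ Y).Nonempty)
    (hu : (X ∪ Y).card + 2 ≤ (side c true).card) : Bad c (X ∩ Y) b := by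
  have h1 := nb_strict hreg hconn c (Finset.union_subset hX.sub hY.sub)
    (hX.ne.mono Finset.subset_union_left) (by rw [side_card hk hreg]; omega)
  have h2 : nbS G (X ∪ Y) ⊆ nbS G X ∪ nbS G Y := by
    intro v
    simp only [Finset.mem_union, mem_nbS]
    rintro ⟨x, hx | hx, h⟩
    · exact Or.inl ⟨x, hx, h⟩
    · exact Or.inr ⟨x, hx, h⟩
  have h3 : nbS G (X ∩ Y) ⊆ nbS G X ∩ nbS G Y :=
    Finset.subset_inter (nbS_mono Finset.inter_subset_left) (nbS_mono Finset.inter_subset_right)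
  have h4 := Finset.card_le_card h2
  have h5 := Finset.card_le_card h3
  have h6 := Finset.card_union_add_card_inter (nbS G X) (nbS G Y)
  have h7 := Finset.card_union_add_card_inter X Y
  have h8 := hX.nb
  have h9 := hY.nb
  have h10 := Finset.card_le_card (Finset.inter_subset_union (s := X) (t := Y))
  exact ⟨Finset.inter_subset_left.trans hX.sub, hne, by omega, by omega⟩

lemma no_bad [DecidableEq V] [DecidableRel G.Adj] {k : ℕ} (hk : 3 ≤ k)
    (hreg : ∀ v, G.degree v = k) (hconn : G.Connected) (hvt : IsVertexTransitive G)
    (c : G.Coloring Bool) (X : Finset V) (b : Bool) : ¬ Bad c X b := by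
  intro hbad
  have hk0 : 0 < k := by omega
  have hex : ∃ s, ∃ X b, Bad c X b ∧ X.card = s := ⟨_, X, b, hbad, rfl⟩
  classical
  obtain ⟨X, b, hX, hXs⟩ := Nat.find_spec hex
  have hmin : ∀ Y b, Bad c Y b → Nat.find hex ≤ Y.card := fun Y b hY =>
    Nat.find_min' hex ⟨Y, b, hY, rfl⟩
  generalize Nat.find hex = s at *
  -- s ≥ 2
  have hs2 : 2 ≤ s := by
    by_contra hlt
    have h1 := hX.ne.card_pos
    obtain ⟨x, rfl⟩ := Finset.card_eq_one.1 (show X.card = 1 by omega)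
    have h2 := hX.nb
    have : nbS G {x} = G.neighborFinset x := by ext v; simp [mem_nbS]
    rw [this, G.card_neighborFinset_eq_degree, hreg] at h2
    simp at h2
    omega
  obtain ⟨hd, hdc⟩ := hX.dual hk0 hreg hconn
  have hsm := hmin _ _ hd
  -- two minimal sets are equal or disjoint
  have hdisj : ∀ Y Z b, Bad c Y b → Bad c Z b → Y.card = s → Z.card = s → (Y ∩ Z).Nonempty → Y = Z := by
    intro Y Z b hY hZ hYs hZs hne
    by_contra hYZ
    have h7 := Finset.card_union_add_card_inter Y Z
    have h8 : (Y ∩ Z).card < s := by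
      by_contra hcon
      have h9 : Y ∩ Z = Y := Finset.eq_of_subset_of_card_le Finset.inter_subset_left (by omega)
      have h10 : Y ∩ Z = Z := Finset.eq_of_subset_of_card_le Finset.inter_subset_right (by omega)
      exact hYZ (h9.symm.trans h10)
    have h9 := hne.card_pos
    have := hmin _ _ (hY.uncross hk0 hreg hconn hZ hne (by omega))
    omega
  -- Let T be the neighbourhood of X
  have hT := hX.nb_eq hk0 hreg hconn
  have hsub : ∀ Y, Bad c Y (!b) → Y.card = s → (Y ∩ nbS G X).Nonempty → Y ⊆ nbS G X := by
    intro Y hY hYs hne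
    by_contra hns
    obtain ⟨y, hy, hyn⟩ := Finset.not_subset.1 hns
    have hne' : (Y ∩ (side c (!b) \ nbS G X)).Nonempty :=
      ⟨y, Finset.mem_inter.2 ⟨hy, Finset.mem_sdiff.2 ⟨hY.sub hy, hyn⟩⟩⟩
    have h7 := Finset.card_union_add_card_inter Y (side c (!b) \ nbS G X)
    have h8 : (Y ∩ (side c (!b) \ nbS G X)).card < s := by
      rw [← hYs]
      refine Finset.card_lt_card ⟨Finset.inter_subset_left, fun hc => ?_⟩
      obtain ⟨z, hz⟩ := hne
      rw [Finset.mem_inter] at hz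
      exact (Finset.mem_sdiff.1 (Finset.mem_inter.1 (hc hz.1)).2).2 hz.2
    by_cases hu : (Y ∪ (side c (!b) \ nbS G X)).card + 2 ≤ (side c true).card
    · have := hmin _ _ (hY.uncross hk0 hreg hconn hd hne' hu)
      omega
    · have := hne'.card_pos
      omega
  have hTne : (nbS G X).Nonempty := by rw [← Finset.card_pos]; omega
  obtain ⟨a, ha⟩ := hTne
  have hca : c a = !b := mem_side.1 (nbS_side hX.sub ha)
  obtain ⟨Y, hY, haY, hYs⟩ := hX.move hconn hvt a
  rw [hca] at hY
  have hYT := hsub Y hY (by omega) ⟨a, Finset.mem_inter.2 ⟨haY, ha⟩⟩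
  have h1 := Finset.card_sdiff_add_card_eq_card hYT
  obtain ⟨a', ha'⟩ := Finset.card_eq_one.1 (show (nbS G X \ Y).card = 1 by omega)
  have ha'T : a' ∈ nbS G X \ Y := by rw [ha']; simp
  rw [Finset.mem_sdiff] at ha'T
  have hca' : c a' = !b := mem_side.1 (nbS_side hX.sub ha'T.1)
  obtain ⟨Z, hZ, haZ, hZs⟩ := hX.move hconn hvt a'
  rw [hca'] at hZ
  have hZT := hsub Z hZ (by omega) ⟨a', Finset.mem_inter.2 ⟨haZ, ha'T.1⟩⟩
  have hZY : (Y ∩ Z).Nonempty := by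
    by_contra hem
    rw [Finset.not_nonempty_iff_eq_empty] at hem
    have : Z ⊆ nbS G X \ Y := by
      intro z hz
      refine Finset.mem_sdiff.2 ⟨hZT hz, fun hzY => ?_⟩
      have : z ∈ Y ∩ Z := Finset.mem_inter.2 ⟨hzY, hz⟩
      rw [hem] at this
      simp at this
    have := Finset.card_le_card this
    omega
  have := hdisj Y Z _ hY hZ (by omega) (by omega) hZY
  exact ha'T.2 (this ▸ haZ)

lemma perfect_of_fun (c : G.Coloring Bool) (hc : (side c false).card = (side c true).card)
    (F : V → V) (hF : ∀ a, c a = true → G.Adj a (F a))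
    (hinj : ∀ a a', c a = true → c a' = true → F a = F a' → a = a') :
    ∃ P : G.Subgraph, P.IsPerfectMatching ∧ ∀ a, c a = true → P.Adj a (F a) := by
  classical
  have hFc : ∀ a, c a = true → c (F a) = false := by
    intro a ha
    have := c.valid (hF a ha)
    rw [ha] at this
    simpa using this.symm
  have hsurj : ∀ v, c v = false → ∃ a, c a = true ∧ F a = v := by
    have himg : (side c true).image F = side c false := by
      refine Finset.eq_of_subset_of_card_le ?_ ?_
      · intro v hv
        obtain ⟨a, ha, rfl⟩ := Finset.mem_image.1 hv
        exact mem_side.2 (hFc a (mem_side.1 ha))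
      · rw [Finset.card_image_of_injOn, hc]
        intro a ha a' ha' h
        exact hinj a a' (mem_side.1 (Finset.mem_coe.1 ha)) (mem_side.1 (Finset.mem_coe.1 ha')) h
    intro v hv
    have : v ∈ (side c true).image F := by rw [himg]; exact mem_side.2 hv
    obtain ⟨a, ha, rfl⟩ := Finset.mem_image.1 this
    exact ⟨a, mem_side.1 ha, rfl⟩
  refine ⟨{ verts := Set.univ
            Adj := fun u v => (c u = true ∧ v = F u) ∨ (c v = true ∧ u = F v)
            adj_sub := ?_
            edge_vert := fun _ => Set.mem_univ _
            symm := ?_ }, ?_, ?_⟩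
  · rintro u v (⟨h, rfl⟩ | ⟨h, rfl⟩)
    · exact hF u h
    · exact (hF v h).symm
  · first
    | exact ⟨fun u v h => h.symm⟩
    | exact fun u v h => h.symm
  · rw [Subgraph.isPerfectMatching_iff]
    intro v
    cases hv : c v
    · obtain ⟨a, ha, rfl⟩ := hsurj v hv
      refine ⟨a, Or.inr ⟨ha, rfl⟩, ?_⟩
      rintro y (⟨h, -⟩ | ⟨h, h'⟩)
      · rw [hv] at h; simp at h
      · exact hinj _ _ h ha h'.symm
    · refine ⟨F v, Or.inl ⟨hv, rfl⟩, ?_⟩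
      rintro y (⟨h, h'⟩ | ⟨h, h'⟩)
      · exact h'
      · have := hFc y h
        rw [← h', hv] at this
        simp at this
  · intro a ha
    exact Or.inl ⟨ha, rfl⟩

lemma extend_two [DecidableEq V] [DecidableRel G.Adj] {k : ℕ} (hk : 3 ≤ k)
    (hreg : ∀ v, G.degree v = k) (hconn : G.Connected) (hvt : IsVertexTransitive G)
    (c : G.Coloring Bool) {a₁ a₂ b₁ b₂ : V} (ha₁ : c a₁ = true) (ha₂ : c a₂ = true)
    (h₁ : G.Adj a₁ b₁) (h₂ : G.Adj a₂ b₂) (ha : a₁ ≠ a₂) (hb : b₁ ≠ b₂) :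
    ∃ P : G.Subgraph, P.IsPerfectMatching ∧ P.Adj a₁ b₁ ∧ P.Adj a₂ b₂ := by
  have hk0 : 0 < k := by omega
  let ι := {a : V // c a = true ∧ a ≠ a₁ ∧ a ≠ a₂}
  let t : ι → Finset V := fun a => G.neighborFinset a.1 \ {b₁, b₂}
  have hall : ∀ s : Finset ι, s.card ≤ (s.biUnion t).card := by
    intro s
    rcases s.eq_empty_or_nonempty with rfl | hs
    · simp
    let X : Finset V := s.map (Function.Embedding.subtype _)
    have hXc : X.card = s.card := by simp [X]
    have hXs : X ⊆ side c true := by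
      intro x hx
      obtain ⟨a, _, rfl⟩ := Finset.mem_map.1 hx
      exact mem_side.2 a.2.1
    have hXne : X.Nonempty := by simpa [X] using hs
    have hXle : X.card + 2 ≤ (side c true).card := by
      have hd : Disjoint X {a₁, a₂} := by
        rw [Finset.disjoint_left]
        intro x hx hx'
        obtain ⟨a, _, rfl⟩ := Finset.mem_map.1 hx
        have := a.2
        simp only [Finset.mem_insert, Finset.mem_singleton] at hx'
        rcases hx' with h | h
        · exact this.2.1 h
        · exact this.2.2 h
      rw [← Finset.card_pair ha, ← Finset.card_union_of_disjoint hd]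
      refine Finset.card_le_card (Finset.union_subset hXs ?_)
      intro x hx
      simp only [Finset.mem_insert, Finset.mem_singleton] at hx
      rcases hx with rfl | rfl <;> exact mem_side.2 (by assumption)
    have hnb : X.card + 2 ≤ (nbS G X).card := by
      by_contra hcon
      exact no_bad hk hreg hconn hvt c X true ⟨hXs, hXne, hXle, by omega⟩
    have : nbS G X \ {b₁, b₂} ⊆ s.biUnion t := by
      intro v hv
      rw [Finset.mem_sdiff, mem_nbS] at hv
      obtain ⟨⟨x, hx, hxv⟩, hv2⟩ := hv
      obtain ⟨a, has, rfl⟩ := Finset.mem_map.1 hx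
      exact Finset.mem_biUnion.2 ⟨a, has, Finset.mem_sdiff.2 ⟨by simpa using hxv, hv2⟩⟩
    have h1 := Finset.card_le_card this
    have h2 := Finset.le_card_sdiff {b₁, b₂} (nbS G X)
    have h3 := Finset.card_pair hb
    omega
  obtain ⟨f, hfi, hft⟩ := (Finset.all_card_le_biUnion_card_iff_exists_injective t).1 hall
  have hft' : ∀ a : ι, G.Adj a.1 (f a) ∧ f a ≠ b₁ ∧ f a ≠ b₂ := by
    intro a
    have := hft a
    simpa [t] using this
  let F : V → V := fun a => if h : c a = true ∧ a ≠ a₁ ∧ a ≠ a₂ then f ⟨a, h⟩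
    else if a = a₁ then b₁ else b₂
  have hF1 : F a₁ = b₁ := by simp [F]
  have hF2 : F a₂ = b₂ := by simp [F, ha.symm]
  have hF3 : ∀ a (h : c a = true ∧ a ≠ a₁ ∧ a ≠ a₂), F a = f ⟨a, h⟩ := by
    intro a h
    simp only [F, dif_pos h]
  have hcases : ∀ a, c a = true → a = a₁ ∨ a = a₂ ∨ (c a = true ∧ a ≠ a₁ ∧ a ≠ a₂) := by
    intro a h; tauto
  obtain ⟨P, hP, hPF⟩ := perfect_of_fun c (side_card hk0 hreg c false) F
    (by
      intro a h
      rcases hcases a h with rfl | rfl | h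
      · rwa [hF1]
      · rwa [hF2]
      · rw [hF3 a h]; exact (hft' ⟨a, h⟩).1)
    (by
      intro a a' h h' he
      rcases hcases a h with rfl | rfl | h <;> rcases hcases a' h' with rfl | rfl | h'
      · rfl
      · rw [hF1, hF2] at he; exact absurd he hb
      · rw [hF1, hF3 _ h'] at he; exact absurd he.symm (hft' _).2.1
      · rw [hF1, hF2] at he; exact absurd he.symm hb
      · rfl
      · rw [hF2, hF3 _ h'] at he; exact absurd he.symm (hft' _).2.2
      · rw [hF1, hF3 _ h] at he; exact absurd he (hft' _).2.1
      · rw [hF2, hF3 _ h] at he; exact absurd he (hft' _).2.2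
      · rw [hF3 _ h, hF3 _ h'] at he
        exact congrArg Subtype.val (hfi he))
  exact ⟨P, hP, hF1 ▸ hPF a₁ ha₁, hF2 ▸ hPF a₂ ha₂⟩

lemma ext_of_deg [DecidableEq V] [DecidableRel G.Adj] {k : ℕ} (hk : 3 ≤ k)
    (hreg : ∀ v, G.degree v = k) (hconn : G.Connected) (hvt : IsVertexTransitive G)
    (c : G.Coloring Bool) (hcard : 6 ≤ Fintype.card V) : IsNExtendable G 2 := by
  have hk0 : 0 < k := by omega
  refine ⟨by omega, ?_, ?_⟩
  · have hm := side_total hk0 hreg c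
    obtain ⟨a₁, ha₁, a₂, ha₂, hne⟩ := Finset.one_lt_card.1 (show 1 < (side c true).card by omega)
    rw [mem_side] at ha₁ ha₂
    obtain ⟨b₁, hb₁⟩ := (G.degree_pos_iff_exists_adj a₁).1 (by rw [hreg]; omega)
    have : 1 < (G.neighborFinset a₂).card := by
      rw [G.card_neighborFinset_eq_degree, hreg]; omega
    obtain ⟨b₂, hb₂, hbne⟩ := Finset.exists_mem_ne this b₁
    rw [mem_neighborFinset] at hb₂
    have hcb₁ := c.valid hb₁
    have hcb₂ := c.valid hb₂
    have e1 : a₁ ≠ b₂ := by rintro rfl; simp_all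
    have e2 : a₂ ≠ b₁ := by rintro rfl; simp_all
    refine ⟨G.subgraphOfAdj hb₁ ⊔ G.subgraphOfAdj hb₂, ?_, ?_⟩
    · refine (Subgraph.IsMatching.subgraphOfAdj hb₁).sup (Subgraph.IsMatching.subgraphOfAdj hb₂) ?_
      rw [(Subgraph.IsMatching.subgraphOfAdj hb₁).support_eq_verts,
        (Subgraph.IsMatching.subgraphOfAdj hb₂).support_eq_verts]
      simp [Set.disjoint_left, hne, e1, e2.symm, hbne.symm]
    · rw [Subgraph.edgeSet_sup, edgeSet_subgraphOfAdj, edgeSet_subgraphOfAdj]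
      rw [Set.singleton_union, Set.ncard_pair]
      simp [hne, e1]
  · intro M hM hMc
    obtain ⟨e₁, e₂, hne, he⟩ := Set.ncard_eq_two.1 hMc
    have key : ∀ e ∈ M.edgeSet, ∃ a b, e = s(a, b) ∧ c a = true ∧ M.Adj a b := by
      intro e
      induction e with
      | _ x y =>
        intro h
        rw [Subgraph.mem_edgeSet] at h
        cases hx : c x
        · refine ⟨y, x, Sym2.eq_swap, ?_, h.symm⟩
          have := c.valid h.adj_sub
          rw [hx] at this
          simpa using this.symm
        · exact ⟨x, y, rfl, hx, h⟩
    obtain ⟨a₁, b₁, rfl, ha₁, h₁⟩ := key e₁ (by simp [he])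
    obtain ⟨a₂, b₂, rfl, ha₂, h₂⟩ := key e₂ (by simp [he])
    have ha : a₁ ≠ a₂ := by
      rintro rfl
      exact hne (by rw [hM.eq_of_adj_left h₁ h₂])
    have hb : b₁ ≠ b₂ := by
      rintro rfl
      exact hne (by rw [hM.eq_of_adj_left h₁.symm h₂.symm])
    obtain ⟨P, hP, hP1, hP2⟩ := extend_two hk hreg hconn hvt c ha₁ ha₂ h₁.adj_sub h₂.adj_sub ha hb
    refine ⟨P, hP, ?_⟩
    rw [he]
    rintro e (rfl | rfl)
    · exact hP1
    · exact hP2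

lemma cycle_of_deg [DecidableEq V] [DecidableRel G.Adj]
    (hreg : ∀ v, G.degree v = 2) (hconn : G.Connected) :
    ∃ n : ℕ, Nonempty (G ≃g SimpleGraph.cycleGraph n) := by
  have hcyc : G.IsCycles := by
    intro v _
    rw [Set.ncard_eq_toFinset_card', ← hreg v, ← G.card_neighborFinset_eq_degree]
    rfl
  obtain ⟨v⟩ := hconn.nonempty
  obtain ⟨w, hw⟩ := (G.degree_pos_iff_exists_adj v).1 (by rw [hreg]; omega)
  obtain ⟨p, hp, -⟩ := hcyc.exists_cycle_toSubgraph_verts_eq_connectedComponentSupp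
    (c := G.connectedComponentMk v) (v := v) rfl ⟨w, hw⟩
  have h3 := hp.three_le_length
  obtain ⟨f⟩ := (cycleGraph_isContained_iff (by omega)).2 ⟨v, p, hp, rfl⟩
  generalize p.length = n at *
  obtain ⟨n, rfl⟩ : ∃ m, n = m + 3 := ⟨n - 3, by omega⟩
  have hadj : ∀ {i j}, (cycleGraph (n+3)).Adj i j → G.Adj (f i) (f j) := fun h => f.toHom.map_adj h
  have hinj : Function.Injective f := f.injective
  have hnb : ∀ i, ((cycleGraph (n+3)).neighborFinset i).image f = G.neighborFinset (f i) := by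
    intro i
    refine Finset.eq_of_subset_of_card_le ?_ ?_
    · intro x hx
      obtain ⟨j, hj, rfl⟩ := Finset.mem_image.1 hx
      rw [mem_neighborFinset] at hj ⊢
      exact hadj hj
    · rw [Finset.card_image_of_injective _ hinj, card_neighborFinset_eq_degree,
        card_neighborFinset_eq_degree, hreg, cycleGraph_degree_three_le]
  have hsurj : Function.Surjective f := by
    have := closed_univ hconn (X := Finset.univ.image f) ⟨f 0, by simp⟩ (by
      intro x hx
      obtain ⟨y, hy, hyx⟩ := mem_nbS.1 hx
      obtain ⟨i, _, rfl⟩ := Finset.mem_image.1 hy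
      rw [← mem_neighborFinset, ← hnb] at hyx
      exact Finset.image_subset_image (Finset.subset_univ _) hyx)
    intro x
    simpa using this x
  refine ⟨n + 3, ⟨RelIso.symm ⟨Equiv.ofBijective f ⟨hinj, hsurj⟩, ?_⟩⟩⟩
  intro i j
  refine ⟨fun h => ?_, fun h => hadj h⟩
  have h' : G.Adj (f i) (f j) := h
  rw [← mem_neighborFinset, ← hnb, Finset.mem_image] at h'
  obtain ⟨j', hj', he⟩ := h'
  rw [hinj he] at hj'
  simpa using hj'

lemma not_ext_cycle (hcard : 6 ≤ Fintype.card V) (n : ℕ) (e : G ≃g SimpleGraph.cycleGraph n) :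
    ¬ IsNExtendable G 2 := by
  have hn : Fintype.card V = n := by simpa using Fintype.card_congr e.toEquiv
  obtain ⟨n, rfl⟩ : ∃ m, n = m + 6 := ⟨n - 6, by omega⟩
  rintro ⟨-, -, h⟩
  have hadj : ∀ i j : Fin (n + 6), (cycleGraph (n + 6)).Adj i j → G.Adj (e.symm i) (e.symm j) :=
    fun i j h => e.symm.map_adj_iff.2 h
  let x : ℕ → Fin (n + 6) := fun i => ⟨i % (n + 6), Nat.mod_lt _ (by omega)⟩
  have hx : ∀ i < 5, (x i).val = i := fun i hi => Nat.mod_eq_of_lt (by omega)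
  have hxn : ∀ i < 5, ∀ j < 5, i ≠ j → e.symm (x i) ≠ e.symm (x j) := by
    intro i hi j hj hij he
    have := congrArg Fin.val (e.symm.injective he)
    rw [hx i hi, hx j hj] at this
    exact hij this
  have hsucc : ∀ i < 4, (cycleGraph (n + 6)).Adj (x i) (x (i + 1)) := by
    intro i hi
    rw [cycleGraph_adj']
    right
    rw [Fin.sub_val_of_le]
    · rw [hx _ (by omega), hx _ (by omega)]; omega
    · rw [Fin.le_def, hx _ (by omega), hx _ (by omega)]; omega
  have h01 := hadj _ _ (hsucc 0 (by omega))
  have h34 := hadj _ _ (hsucc 3 (by omega))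
  have hM1 := Subgraph.IsMatching.subgraphOfAdj h01
  have hM2 := Subgraph.IsMatching.subgraphOfAdj h34
  have n03 := hxn 0 (by omega) 3 (by omega) (by omega)
  have n04 := hxn 0 (by omega) 4 (by omega) (by omega)
  have n13 := hxn 1 (by omega) 3 (by omega) (by omega)
  have n14 := hxn 1 (by omega) 4 (by omega) (by omega)
  have n02 := hxn 0 (by omega) 2 (by omega) (by omega)
  have n24 := hxn 2 (by omega) 4 (by omega) (by omega)
  obtain ⟨P, hP, hPM⟩ := h (G.subgraphOfAdj h01 ⊔ G.subgraphOfAdj h34)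
    (hM1.sup hM2 (by
      rw [hM1.support_eq_verts, hM2.support_eq_verts]
      simp only [subgraphOfAdj_verts, Set.disjoint_left, Set.mem_insert_iff, Set.mem_singleton_iff]
      rintro a (rfl | rfl) (h | h)
      · exact n03 h
      · exact n04 h
      · exact n13 h
      · exact n14 h))
    (by
      rw [Subgraph.edgeSet_sup, edgeSet_subgraphOfAdj, edgeSet_subgraphOfAdj,
        Set.singleton_union, Set.ncard_pair]
      intro he
      rw [Sym2.eq_iff] at he
      rcases he with he | he
      · exact n03 he.1
      · exact n04 he.1)
  rw [Subgraph.edgeSet_sup, edgeSet_subgraphOfAdj, edgeSet_subgraphOfAdj] at hPM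
  have p01 : P.Adj (e.symm (x 0)) (e.symm (x 1)) := hPM (Or.inl rfl)
  have p34 : P.Adj (e.symm (x 3)) (e.symm (x 4)) := hPM (Or.inr rfl)
  obtain ⟨y, hy, -⟩ := hP.1 (hP.2 (e.symm (x 2)))
  have hy' : (cycleGraph (n + 6)).Adj (x 2) (e y) := by
    rw [← e.symm.map_adj_iff]; simpa using hy.adj_sub
  have hnb : e y ∈ (cycleGraph (n + 4 + 2)).neighborSet (x 2) := hy'
  rw [cycleGraph_neighborSet] at hnb
  have a1 : x 2 - 1 = x 1 := by
    rw [sub_eq_iff_eq_add]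
    ext
    simp [x, Fin.val_add]
  have a3 : x 2 + 1 = x 3 := by
    ext
    simp [x, Fin.val_add]
  rw [a1, a3] at hnb
  rcases hnb with h | h
  · have : y = e.symm (x 1) := by rw [← h]; simp
    subst this
    exact n02 (hP.1.eq_of_adj_left p01.symm hy.symm)
  · have : y = e.symm (x 3) := by rw [← (Set.mem_singleton_iff.1 h)]; simp
    subst this
    exact n24 (hP.1.eq_of_adj_left p34 hy.symm).symm

end aux

/-- A finite connected bipartite vertex-transitive graph with at least 6 vertices is
2-extendable iff it is not isomorphic to a cycle graph. -/
theorem bipartite_vertexTransitive_two_extendable_iff {V : Type*} [Fintype V]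
    (G : SimpleGraph V) (hconn : G.Connected) (hbip : G.Colorable 2)
    (hvt : IsVertexTransitive G) (hcard : 6 ≤ Fintype.card V) :
    IsNExtendable G 2 ↔ ¬ ∃ n : ℕ, Nonempty (G ≃g SimpleGraph.cycleGraph n) := by
  constructor
  · rintro h ⟨n, ⟨e⟩⟩
    exact not_ext_cycle hcard n e h
  · intro hnc
    classical
    have c : G.Coloring Bool := hbip.toColoring (by simp)
    obtain ⟨v⟩ := hconn.nonempty
    have hreg : ∀ w, G.degree w = G.degree v := by
      intro w
      obtain ⟨φ, rfl⟩ := hvt v w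
      exact φ.degree_eq v
    have : Nontrivial V := Fintype.one_lt_card_iff_nontrivial.1 (by omega)
    have h0 : 0 < G.degree v := hconn.preconnected.degree_pos_of_nontrivial v
    by_cases h1 : G.degree v = 1
    · exfalso
      have hn : (nbS G {v}).card = 1 := by
        rw [← h1, ← G.card_neighborFinset_eq_degree]
        congr 1
        ext w; simp [mem_nbS]
      have h := nb_tight hreg hconn {v} (by simp) (by simp [hn])
      have h2 := Finset.card_le_card (show Finset.univ ⊆ {v} ∪ nbS G {v} from fun w _ => h w)
      have h3 := Finset.card_union_le {v} (nbS G {v})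
      rw [Finset.card_univ] at h2
      rw [hn, Finset.card_singleton] at h3
      omega
    by_cases h2 : G.degree v = 2
    · exact absurd (cycle_of_deg (fun w => (hreg w).trans h2) hconn) hnc
    · exact ext_of_deg (by omega) hreg hconn hvt c hcard
end

section
/- Let G be a finite connected k-regular vertex-transitive graph (k ≥ 2) that contains no k-clique. Then the edge-connectivity of G equals k and every edge-cut of G of cardinality k is trivial, i.e., equals the set of k edges incident with some single vertex. -/
open SimpleGraph

/-- `F` is an edge-cut of `G`: a set of edges of `G` whose removal disconnects `G`. -/
def IsEdgeCut {V : Type*} (G : SimpleGraph V) (F : Set (Sym2 V)) : Prop :=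
  F ⊆ G.edgeSet ∧ ¬ (G.deleteEdges F).Connected

/-- `F` is a cyclic edge-cut of `G`: a set of edges of `G` such that `G - F` has at least
two components containing cycles. -/
def IsCyclicEdgeCut {V : Type*} (G : SimpleGraph V) (F : Set (Sym2 V)) : Prop :=
  F ⊆ G.edgeSet ∧
    ∃ (u v : V) (c : (G.deleteEdges F).Walk u u) (c' : (G.deleteEdges F).Walk v v),
      c.IsCycle ∧ c'.IsCycle ∧ ¬ (G.deleteEdges F).Reachable u v

/-- Some connected component of `H` is a cycle of length `n`: there is a cycle `c`
of length `n` such that the component of its base vertex has exactly the vertices and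
edges of `c`. -/
def HasCycleComponentOfLength {V : Type*} (H : SimpleGraph V) (n : ℕ) : Prop :=
  ∃ (u : V) (c : H.Walk u u), c.IsCycle ∧ c.length = n ∧
    (∀ w, H.Reachable u w → w ∈ c.support) ∧
    (∀ e ∈ H.edgeSet, (∃ w, w ∈ e ∧ H.Reachable u w) → e ∈ c.edges)

section CutAux
open Finset
open scoped Classical

variable {V : Type*} [Fintype V]

noncomputable def cutD (G : SimpleGraph V) (X : Finset V) : ℕ :=
  ∑ x, ∑ y, if G.Adj x y ∧ x ∈ X ∧ y ∉ X then 1 else 0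

lemma cutD_compl (G : SimpleGraph V) (X : Finset V) : cutD G Xᶜ = cutD G X := by
  unfold cutD
  rw [Finset.sum_comm]
  refine Finset.sum_congr rfl fun x _ => Finset.sum_congr rfl fun y _ => ?_
  refine if_congr ?_ rfl rfl
  simp only [Finset.mem_compl, not_not, G.adj_comm y x]
  tauto

lemma cutD_submod (G : SimpleGraph V) (X Y : Finset V) :
    cutD G (X ∩ Y) + cutD G (X ∪ Y) ≤ cutD G X + cutD G Y := by
  unfold cutD
  simp only [← Finset.sum_add_distrib]
  refine Finset.sum_le_sum fun x _ => Finset.sum_le_sum fun y _ => ?_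
  simp only [Finset.mem_inter, Finset.mem_union]
  by_cases h : G.Adj x y <;> by_cases a : x ∈ X <;> by_cases b : x ∈ Y <;>
    by_cases c : y ∈ X <;> by_cases d : y ∈ Y <;> simp [h, a, b, c, d]

lemma cutD_submod' (G : SimpleGraph V) (X Y : Finset V) :
    cutD G (X \ Y) + cutD G (Y \ X) ≤ cutD G X + cutD G Y := by
  have h := cutD_submod G X Yᶜ
  rw [cutD_compl G Y, ← cutD_compl G (X ∪ Yᶜ)] at h
  have e1 : X ∩ Yᶜ = X \ Y := by ext; simp
  have e2 : (X ∪ Yᶜ)ᶜ = Y \ X := by ext; simp; tauto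
  rwa [e1, e2] at h

lemma cutD_eq_sum (G : SimpleGraph V) (X : Finset V) :
    cutD G X = ∑ x ∈ X, (G.neighborFinset x \ X).card := by
  unfold cutD
  rw [← Finset.sum_subset (Finset.subset_univ X)]
  · refine Finset.sum_congr rfl fun x hx => ?_
    rw [Finset.sum_boole]
    simp only [Nat.cast_id]
    congr 1
    ext y; simp [hx]
  · intro x _ hx
    simp [hx]

lemma cutD_map (G : SimpleGraph V) (φ : G ≃g G) (X : Finset V) :
    cutD G (X.map φ.toEquiv.toEmbedding) = cutD G X := by
  unfold cutD
  rw [← Equiv.sum_comp φ.toEquiv]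
  refine Finset.sum_congr rfl fun x _ => ?_
  rw [← Equiv.sum_comp φ.toEquiv]
  refine Finset.sum_congr rfl fun y _ => ?_
  refine if_congr ?_ rfl rfl
  have h1 : G.Adj (φ.toEquiv x) (φ.toEquiv y) ↔ G.Adj x y := φ.map_adj_iff
  rw [h1]
  have h2 : ∀ z, φ.toEquiv z ∈ X.map φ.toEquiv.toEmbedding ↔ z ∈ X := fun z =>
    Finset.mem_map' φ.toEquiv.toEmbedding
  rw [h2, h2]

lemma cutD_single (G : SimpleGraph V) (v : V) : cutD G {v} = G.degree v := by
  rw [cutD_eq_sum]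
  simp only [Finset.sum_singleton]
  rw [← G.card_neighborFinset_eq_degree]
  congr 1
  ext y
  simp only [Finset.mem_sdiff, SimpleGraph.mem_neighborFinset, Finset.mem_singleton]
  exact ⟨fun h => h.1, fun h => ⟨h, fun e => G.loopless.irrefl v (e ▸ h)⟩⟩

lemma out_ge (G : SimpleGraph V) (k : ℕ) (hreg : ∀ v, G.degree v = k) (X : Finset V) (x : V)
    (hx : x ∈ X) : k + 1 ≤ (G.neighborFinset x \ X).card + X.card := by
  have h1 : G.neighborFinset x ⊆ (G.neighborFinset x \ X) ∪ X.erase x := by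
    intro y hy
    have : y ≠ x := by
      rintro rfl
      simp at hy
    by_cases h : y ∈ X <;> simp_all
  have h2 := (Finset.card_le_card h1).trans (Finset.card_union_le _ _)
  rw [G.card_neighborFinset_eq_degree, hreg, Finset.card_erase_of_mem hx] at h2
  have := Finset.card_pos.2 ⟨x, hx⟩
  omega

lemma out_ge' (G : SimpleGraph V) (k : ℕ) (hreg : ∀ v, G.degree v = k) (X : Finset V) (x y : V)
    (hx : x ∈ X) (hy : y ∈ X) (hxy : x ≠ y) (hn : ¬ G.Adj x y) :
    k + 2 ≤ (G.neighborFinset x \ X).card + X.card := by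
  have h1 : G.neighborFinset x ⊆ (G.neighborFinset x \ X) ∪ (X.erase x).erase y := by
    intro z hz
    have h1 : z ≠ x := by
      rintro rfl
      simp at hz
    have h2 : z ≠ y := by
      rintro rfl
      simp at hz
      exact hn hz
    by_cases h : z ∈ X <;> simp_all
  have h2 := (Finset.card_le_card h1).trans (Finset.card_union_le _ _)
  have hy' : y ∈ X.erase x := by simp [hy, hxy.symm]
  rw [G.card_neighborFinset_eq_degree, hreg, Finset.card_erase_of_mem hy',
    Finset.card_erase_of_mem hx] at h2
  have := Finset.card_pos.2 ⟨_, hy'⟩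
  rw [Finset.card_erase_of_mem hx] at this
  omega

lemma card_gt (G : SimpleGraph V) (k : ℕ) (hreg : ∀ v, G.degree v = k)
    (hcf : G.CliqueFree k) (X : Finset V) (h2 : 2 ≤ X.card) (hd : cutD G X ≤ k) :
    k + 1 ≤ X.card := by
  by_contra hlt
  obtain ⟨j, hj⟩ : ∃ j, k = X.card + j := ⟨k - X.card, by omega⟩
  have hsum : X.card * (j + 1) ≤ cutD G X := by
    rw [cutD_eq_sum, ← smul_eq_mul]
    refine Finset.card_nsmul_le_sum _ _ _ fun x hx => ?_
    have := out_ge G k hreg X x hx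
    omega
  have hj0 : j = 0 := by
    by_contra h
    have : 1 ≤ j := by omega
    nlinarith
  subst hj0
  refine hcf X ⟨?_, by omega⟩
  intro x hx y hy hxy
  by_contra hn
  have : ∑ x ∈ X, 1 < ∑ x ∈ X, (G.neighborFinset x \ X).card := by
    refine Finset.sum_lt_sum (fun z hz => ?_) ⟨x, hx, ?_⟩
    · have := out_ge G k hreg X z hz
      omega
    · have := out_ge' G k hreg X x y hx hy hxy hn
      omega
  rw [← cutD_eq_sum] at this
  simp at this
  omega

lemma exists_cross (G : SimpleGraph V) (hconn : G.Connected) (X : Finset V)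
    (h : X.Nonempty) (hc : Xᶜ.Nonempty) : ∃ x ∈ X, ∃ y, y ∉ X ∧ G.Adj x y := by
  obtain ⟨x, hx⟩ := h
  obtain ⟨y, hy⟩ := hc
  obtain ⟨p⟩ := hconn.preconnected x y
  obtain ⟨d, _, h1, h2⟩ := p.exists_boundary_dart (X : Set V) (by simpa using hx)
    (by simpa using hy)
  exact ⟨d.fst, by simpa using h1, d.snd, by simpa using h2, d.adj⟩

lemma no_bad_s5 (G : SimpleGraph V) (k : ℕ) (hk : 2 ≤ k) (hconn : G.Connected)
    (hreg : ∀ v, G.degree v = k) (hvt : IsVertexTransitive G) (hcf : G.CliqueFree k)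
    (X₀ : Finset V) (h0 : 2 ≤ X₀.card) (h0' : 2 ≤ X₀ᶜ.card) : k < cutD G X₀ := by
  by_contra hle
  push Not at hle
  let B : Finset (Finset V) :=
    Finset.univ.filter fun X => 2 ≤ X.card ∧ 2 ≤ Xᶜ.card ∧ cutD G X ≤ k
  have hB : ∀ X, X ∈ B ↔ 2 ≤ X.card ∧ 2 ≤ Xᶜ.card ∧ cutD G X ≤ k := by simp [B]
  obtain ⟨X₁, hX₁, hmin₁⟩ := Finset.exists_min_image B (cutD G) ⟨X₀, (hB _).2 ⟨h0, h0', hle⟩⟩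
  obtain ⟨X, hX, hmin⟩ := Finset.exists_min_image (B.filter fun X => cutD G X = cutD G X₁)
    Finset.card ⟨X₁, by simp [hX₁]⟩
  rw [Finset.mem_filter] at hX
  obtain ⟨hXB, hXe⟩ := hX
  obtain ⟨hX2, hXc2, hXk⟩ := (hB _).1 hXB
  rw [← hXe] at hmin₁ hmin
  have hbig := card_gt G k hreg hcf X hX2 hXk
  have hsingle : ∀ Z : Finset V, Z.card = 1 → cutD G Z = k := by
    intro Z hZ
    obtain ⟨v, rfl⟩ := Finset.card_eq_one.1 hZ
    rw [cutD_single, hreg]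
  have hlow : ∀ Z : Finset V, Z.Nonempty → Zᶜ.Nonempty → cutD G X ≤ cutD G Z := by
    intro Z hZ hZc
    by_contra hlt
    have a1 := Finset.card_pos.2 hZ
    have a2 := Finset.card_pos.2 hZc
    by_cases b1 : Z.card = 1
    · have := hsingle Z b1
      omega
    by_cases b2 : Zᶜ.card = 1
    · have := hsingle _ b2
      rw [cutD_compl] at this
      omega
    have := hmin₁ Z ((hB _).2 ⟨by omega, by omega, by omega⟩)
    omega
  have hsm : ∀ Z : Finset V, 2 ≤ Z.card → 2 ≤ Zᶜ.card → cutD G Z = cutD G X →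
      X.card ≤ Z.card := by
    intro Z a b c
    exact hmin Z (Finset.mem_filter.2 ⟨(hB _).2 ⟨a, b, by omega⟩, c⟩)
  have hhalf : X.card ≤ Xᶜ.card := hsm _ hXc2 (by simpa using hX2) (cutD_compl G X)
  have hblock : ∀ φ : G ≃g G, ∀ y ∈ X, y ∈ X.map φ.toEquiv.toEmbedding →
      X.map φ.toEquiv.toEmbedding = X := by
    intro φ y hy hy'
    by_contra hne
    have hYc : (X.map φ.toEquiv.toEmbedding).card = X.card := Finset.card_map _
    have hYd := cutD_map G φ X
    generalize X.map φ.toEquiv.toEmbedding = Y at *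
    have hV : X.card + Xᶜ.card = Fintype.card V := Finset.card_add_card_compl X
    have hcomp : ∀ Z : Finset V, Z.card + Zᶜ.card = Fintype.card V :=
      Finset.card_add_card_compl
    have hI : 0 < (X ∩ Y).card := Finset.card_pos.2 ⟨y, by simp [hy, hy']⟩
    have hUI := Finset.card_union_add_card_inter X Y
    have hsI := Finset.card_sdiff_add_card_inter X Y
    have hsI' := Finset.card_sdiff_add_card_inter Y X
    rw [Finset.inter_comm Y X] at hsI'
    have hD : 0 < (X \ Y).card := by
      rw [Finset.card_pos, Finset.sdiff_nonempty]
      intro hsub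
      exact hne (Finset.eq_of_subset_of_card_le hsub (by omega)).symm
    have c1 := hcomp (X ∩ Y)
    have c2 := hcomp (X ∪ Y)
    have c3 := hcomp (X \ Y)
    have c4 := hcomp (Y \ X)
    have s1 := cutD_submod G X Y
    have s2 := cutD_submod' G X Y
    have l1 := hlow (X ∩ Y) (Finset.card_pos.1 (by omega)) (Finset.card_pos.1 (by omega))
    have l2 := hlow (X ∪ Y) (Finset.card_pos.1 (by omega)) (Finset.card_pos.1 (by omega))
    have l3 := hlow (X \ Y) (Finset.card_pos.1 (by omega)) (Finset.card_pos.1 (by omega))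
    have l4 := hlow (Y \ X) (Finset.card_pos.1 (by omega)) (Finset.card_pos.1 (by omega))
    have m1 : (X ∩ Y).card < 2 := by
      by_contra h
      have := hsm (X ∩ Y) (by omega) (by omega) (by omega)
      omega
    have m2 : (X \ Y).card < 2 := by
      by_contra h
      have := hsm (X \ Y) (by omega) (by omega) (by omega)
      omega
    omega
  obtain ⟨x, hx, z, hz, hxz⟩ := exists_cross G hconn X (Finset.card_pos.1 (by omega))
    (Finset.card_pos.1 (by omega))
  have : X.card * 1 ≤ cutD G X := by
    rw [cutD_eq_sum, ← smul_eq_mul]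
    refine Finset.card_nsmul_le_sum _ _ _ fun y hy => ?_
    obtain ⟨φ, hφ⟩ := hvt x y
    have hm := hblock φ y hy (Finset.mem_map.2 ⟨x, hx, hφ⟩)
    refine Finset.card_pos.2 ⟨φ z, ?_⟩
    rw [Finset.mem_sdiff, SimpleGraph.mem_neighborFinset]
    constructor
    · rw [← hφ]
      exact φ.map_adj_iff.2 hxz
    · intro h
      rw [← hm] at h
      obtain ⟨w, hw, hwz⟩ := Finset.mem_map.1 h
      have : w = z := φ.injective hwz
      exact hz (this ▸ hw)
  omega

lemma exists_side (G : SimpleGraph V) (hconn : G.Connected) (F : Set (Sym2 V))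
    (hF : IsEdgeCut G F) : ∃ X : Finset V, X.Nonempty ∧ Xᶜ.Nonempty ∧
      ∀ x ∈ X, ∀ y, y ∉ X → G.Adj x y → s(x, y) ∈ F := by
  obtain ⟨_, hn⟩ := hF
  have hne := hconn.nonempty
  have : ¬ (G.deleteEdges F).Preconnected := fun h => hn ⟨h⟩
  unfold SimpleGraph.Preconnected at this
  push Not at this
  obtain ⟨a, b, hab⟩ := this
  refine ⟨Finset.univ.filter fun x => (G.deleteEdges F).Reachable a x,
    ⟨a, by simp⟩, ⟨b, by simpa using hab⟩, ?_⟩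
  intro x hx y hy hxy
  simp only [Finset.mem_filter, Finset.mem_univ, true_and] at hx hy
  by_contra h
  exact hy (hx.trans (SimpleGraph.Adj.reachable (by simp [SimpleGraph.deleteEdges_adj, hxy, h])))

lemma cutD_le_ncard (G : SimpleGraph V) (F : Set (Sym2 V)) (X : Finset V)
    (h : ∀ x ∈ X, ∀ y, y ∉ X → G.Adj x y → s(x, y) ∈ F) : cutD G X ≤ F.ncard := by
  have e : cutD G X =
      ((Finset.univ : Finset (V × V)).filter
        fun p => G.Adj p.1 p.2 ∧ p.1 ∈ X ∧ p.2 ∉ X).card := by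
    unfold cutD
    rw [Finset.card_filter, Fintype.sum_prod_type]
  rw [e, ← Set.ncard_coe_finset]
  refine Set.ncard_le_ncard_of_injOn (fun p => s(p.1, p.2)) ?_ ?_ (Set.toFinite F)
  · rintro ⟨x, y⟩ hp
    simp at hp
    exact h x hp.2.1 y hp.2.2 hp.1
  · rintro ⟨x, y⟩ hp ⟨x', y'⟩ hp' heq
    simp at hp hp' heq
    rcases heq with h | ⟨rfl, rfl⟩
    · simp [h]
    · exact absurd hp.2.1 hp'.2.2

lemma ncard_inc (G : SimpleGraph V) (v : V) : (G.incidenceSet v).ncard = G.degree v := by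
  rw [← G.card_incidenceSet_eq_degree, Set.ncard_eq_toFinset_card', Set.toFinset_card]

lemma main_aux (G : SimpleGraph V) (k : ℕ) (hk : 2 ≤ k) (hconn : G.Connected)
    (hreg : ∀ v, G.degree v = k) (hvt : IsVertexTransitive G) (hcf : G.CliqueFree k) :
    ((∃ F, IsEdgeCut G F ∧ F.ncard = k) ∧ (∀ F, IsEdgeCut G F → k ≤ F.ncard)) ∧
      ∀ F, IsEdgeCut G F → F.ncard = k → ∃ v : V, F = G.incidenceSet v := by
  have key : ∀ X : Finset V, X.Nonempty → Xᶜ.Nonempty →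
      (k < cutD G X) ∨ (cutD G X = k ∧ ∃ v, X = {v} ∨ Xᶜ = {v}) := by
    intro X h1 h2
    have a1 := Finset.card_pos.2 h1
    have a2 := Finset.card_pos.2 h2
    by_cases b1 : X.card = 1
    · obtain ⟨v, rfl⟩ := Finset.card_eq_one.1 b1
      exact Or.inr ⟨by rw [cutD_single, hreg], v, Or.inl rfl⟩
    by_cases b2 : Xᶜ.card = 1
    · obtain ⟨v, hv⟩ := Finset.card_eq_one.1 b2
      exact Or.inr ⟨by rw [← cutD_compl, hv, cutD_single, hreg], v, Or.inr hv⟩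
    exact Or.inl (no_bad_s5 G k hk hconn hreg hvt hcf X (by omega) (by omega))
  refine ⟨⟨?_, ?_⟩, ?_⟩
  · obtain ⟨v⟩ := hconn.nonempty
    refine ⟨G.incidenceSet v, ⟨G.incidenceSet_subset v, ?_⟩, by rw [ncard_inc, hreg]⟩
    intro hc
    have hd : 0 < G.degree v := by rw [hreg]; omega
    obtain ⟨w, hw⟩ := (G.degree_pos_iff_exists_adj v).1 hd
    obtain ⟨x, hx, y, hy, hxy⟩ := exists_cross _ hc {v} ⟨v, by simp⟩ ⟨w, by simp [hw.ne.symm]⟩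
    simp only [Finset.mem_singleton] at hx
    subst hx
    rw [SimpleGraph.deleteEdges_adj] at hxy
    exact hxy.2 ⟨hxy.1, by simp⟩
  · intro F hF
    obtain ⟨X, h1, h2, h3⟩ := exists_side G hconn F hF
    have := cutD_le_ncard G F X h3
    rcases key X h1 h2 with h | h <;> omega
  · intro F hF hFk
    obtain ⟨X, h1, h2, h3⟩ := exists_side G hconn F hF
    have := cutD_le_ncard G F X h3
    rcases key X h1 h2 with h | ⟨-, v, hv⟩
    · omega
    refine ⟨v, (Set.eq_of_subset_of_ncard_le ?_ ?_ (Set.toFinite F)).symm⟩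
    · rintro e ⟨he, hve⟩
      obtain ⟨w, rfl⟩ := hve
      rw [SimpleGraph.mem_edgeSet] at he
      rcases hv with rfl | hv
      · exact h3 v (by simp) w (by simp [he.ne.symm]) he
      · have m : ∀ u, u ∉ X ↔ u = v := fun u => by
          rw [← Finset.mem_compl, hv, Finset.mem_singleton]
        rw [Sym2.eq_swap]
        refine h3 w ?_ v ((m v).2 rfl) he.symm
        by_contra h
        exact he.ne.symm ((m w).1 h)
    · rw [ncard_inc, hreg, hFk]

end CutAux

/-- A finite connected `k`-regular vertex-transitive graph (`k ≥ 2`) with no `k`-clique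
has edge-connectivity `k`, and every edge-cut of cardinality `k` is the set of edges
incident with a single vertex. -/
theorem vertexTransitive_cliqueFree_edgeConnectivity {V : Type*} [Fintype V]
    (G : SimpleGraph V) [DecidableRel G.Adj] (k : ℕ) (hk : 2 ≤ k)
    (hconn : G.Connected) (hreg : G.IsRegularOfDegree k)
    (hvt : IsVertexTransitive G) (hcf : G.CliqueFree k) :
    ((∃ F, IsEdgeCut G F ∧ F.ncard = k) ∧ (∀ F, IsEdgeCut G F → k ≤ F.ncard)) ∧
      ∀ F, IsEdgeCut G F → F.ncard = k → ∃ v : V, F = G.incidenceSet v := by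
  refine main_aux G k hk hconn (fun v => ?_) hvt hcf
  rw [← hreg v]
  congr!
end

section
/- Let G be a finite connected cubic vertex-transitive graph of girth 5 whose order is 10 or 12. Then for every cyclic edge-cut F of G with |F| = 5, some component of G − F is a cycle of length 5. -/
open SimpleGraph

section aux
variable {V : Type*}

lemma aux_girth (G : SimpleGraph V) (hg : G.girth = 5) {u : V} (c : G.Walk u u)
    (hc : c.IsCycle) : 5 ≤ c.length := by
  rw [← hg]; exact hc.girth_le_length

lemma aux_no3 (G : SimpleGraph V) (hg : G.girth = 5) {a b c : V} (h1 : G.Adj a b)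
    (h2 : G.Adj b c) (h3 : G.Adj a c) : False := by
  have hc : (Walk.cons h1 (Walk.cons h2 (Walk.cons h3.symm Walk.nil))).IsCycle := by
    have := h1.ne; have := h2.ne; have := h3.ne
    simp [Walk.isCycle_def, Walk.isTrail_def]
    grind
  have := aux_girth G hg _ hc
  simp at this

lemma aux_no4 (G : SimpleGraph V) (hg : G.girth = 5) {a b c d : V} (h1 : G.Adj a b)
    (h2 : G.Adj b c) (h3 : G.Adj a d) (h4 : G.Adj d c) (hac : a ≠ c) : b = d := by
  by_contra hbd
  have hc : (Walk.cons h1 (Walk.cons h2 (Walk.cons h4.symm (Walk.cons h3.symm Walk.nil)))).IsCycle := by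
    have := h1.ne; have := h2.ne; have := h3.ne; have := h4.ne
    simp [Walk.isCycle_def, Walk.isTrail_def]
    grind
  have := aux_girth G hg _ hc
  simp at this

variable [Fintype V] [DecidableEq V]

lemma aux_moore (H : SimpleGraph V) [DecidableRel H.Adj]
    (h3 : ∀ a b c, H.Adj a b → H.Adj b c → H.Adj a c → False)
    (h4 : ∀ a b c d, H.Adj a b → H.Adj b c → H.Adj a d → H.Adj d c → a ≠ c → b = d)
    (S : Finset V) (hS : ∀ a ∈ S, ∀ b, H.Adj a b → b ∈ S) (v : V) (hv : v ∈ S) :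
    ∑ w ∈ H.neighborFinset v, H.degree w + 1 ≤ S.card := by
  have hT : ∀ w ∈ H.neighborFinset v,
      (insert w ((H.neighborFinset w).erase v)).card = H.degree w := by
    intro w hw
    rw [mem_neighborFinset] at hw
    rw [Finset.card_insert_of_notMem (by simp), Finset.card_erase_of_mem (by simpa using hw.symm),
      card_neighborFinset_eq_degree]
    have : 0 < H.degree w := by
      rw [degree_pos_iff_exists_adj]; exact ⟨v, hw.symm⟩
    omega
  have hd : ((H.neighborFinset v : Finset V) : Set V).PairwiseDisjoint
      (fun w => insert w ((H.neighborFinset w).erase v)) := by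
    intro w hw w' hw' hne
    simp only [Finset.mem_coe, mem_neighborFinset] at hw hw'
    simp only [Function.onFun]
    rw [Finset.disjoint_left]
    intro x hx hx'
    simp only [Finset.mem_insert, Finset.mem_erase, mem_neighborFinset] at hx hx'
    rcases hx with rfl | ⟨hxv, hx⟩
    · rcases hx' with rfl | ⟨hxv', hx'⟩
      · exact hne rfl
      · exact h3 _ _ _ hw' hx' hw
    · rcases hx' with rfl | ⟨hxv', hx'⟩
      · exact h3 _ _ _ hw hx hw'
      · exact hne (h4 _ _ _ _ hw hx hw' hx' (Ne.symm hxv))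
  have hsub : (H.neighborFinset v).biUnion (fun w => insert w ((H.neighborFinset w).erase v))
      ⊆ S.erase v := by
    intro x hx
    simp only [Finset.mem_biUnion, Finset.mem_insert, Finset.mem_erase, mem_neighborFinset] at hx ⊢
    obtain ⟨w, hw, rfl | ⟨hxv, hx⟩⟩ := hx
    · exact ⟨hw.ne.symm, hS _ hv _ hw⟩
    · exact ⟨hxv, hS _ (hS _ hv _ hw) _ hx⟩
  have h := Finset.card_le_card hsub
  rw [Finset.card_biUnion hd, Finset.sum_congr rfl hT, Finset.card_erase_of_mem hv] at h
  have : 0 < S.card := Finset.card_pos.2 ⟨v, hv⟩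
  omega

lemma aux_even (H : SimpleGraph V) [DecidableRel H.Adj]
    (S : Finset V) (hS : ∀ a ∈ S, ∀ b, H.Adj a b → b ∈ S) :
    Even (∑ v ∈ S, H.degree v) := by
  let K : SimpleGraph V :=
    { Adj := fun a b => H.Adj a b ∧ a ∈ S
      symm := ⟨fun a b h => ⟨h.1.symm, hS _ h.2 _ h.1⟩⟩
      loopless := ⟨fun a h => H.loopless.irrefl a h.1⟩ }
  haveI : DecidableRel K.Adj := fun a b => inferInstanceAs (Decidable (H.Adj a b ∧ a ∈ S))
  have hK := K.sum_degrees_eq_twice_card_edges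
  have : ∑ v, K.degree v = ∑ v ∈ S, H.degree v := by
    rw [← Finset.sum_subset (Finset.subset_univ S)]
    · refine Finset.sum_congr rfl fun v hv => ?_
      rw [← card_neighborFinset_eq_degree, ← card_neighborFinset_eq_degree]
      congr 1
      ext x
      simp [K, hv]
    · intro v _ hv
      rw [← card_neighborFinset_eq_degree, Finset.card_eq_zero]
      ext x
      simp [K, hv]
  rw [← this, hK]
  exact even_two_mul _

lemma aux_six (H : SimpleGraph V) [DecidableRel H.Adj]
    (h3 : ∀ a b c, H.Adj a b → H.Adj b c → H.Adj a c → False)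
    (h4 : ∀ a b c d, H.Adj a b → H.Adj b c → H.Adj a d → H.Adj d c → a ≠ c → b = d)
    (S : Finset V) (hS : ∀ a ∈ S, ∀ b, H.Adj a b → b ∈ S) (h6 : S.card = 6) :
    ∑ v ∈ S, H.degree v ≤ 12 := by
  have he := aux_even H S hS
  have h1 : ∑ v ∈ S, ∑ w ∈ H.neighborFinset v, H.degree w ≤ ∑ v ∈ S, 5 := by
    refine Finset.sum_le_sum fun v hv => ?_
    have := aux_moore H h3 h4 S hS v hv
    omega
  have h2 : ∑ v ∈ S, ∑ w ∈ H.neighborFinset v, H.degree w = ∑ w ∈ S, H.degree w * H.degree w := by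
    rw [Finset.sum_comm' (t' := S) (s' := fun w => H.neighborFinset w)]
    · simp
    · intro x y
      simp only [mem_neighborFinset]
      exact ⟨fun h => ⟨h.2.symm, hS _ h.1 _ h.2⟩, fun h => ⟨hS _ h.2 _ h.1, h.1.symm⟩⟩
  have h5 : ∑ w ∈ S, 5 * H.degree w ≤ ∑ w ∈ S, (H.degree w * H.degree w + 6) := by
    refine Finset.sum_le_sum fun v hv => ?_
    rcases Nat.lt_or_ge (H.degree v) 3 with h | h
    · interval_cases H.degree v <;> simp
    · nlinarith
  rw [← Finset.mul_sum, Finset.sum_add_distrib, ← h2] at h5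
  simp [h6] at h1 h5
  obtain ⟨k, hk⟩ := he
  omega

lemma aux_comp (H : SimpleGraph V) [DecidableRel H.Adj]
    (h3 : ∀ a b c, H.Adj a b → H.Adj b c → H.Adj a c → False)
    (h4 : ∀ a b c d, H.Adj a b → H.Adj b c → H.Adj a d → H.Adj d c → a ≠ c → b = d)
    (S : Finset V) (u : V) (hS : ∀ w, w ∈ S ↔ H.Reachable u w) (c : H.Walk u u)
    (hc : c.IsCycle) (h5 : 5 ≤ c.length) :
    5 ≤ S.card ∧ (S.card = 5 → HasCycleComponentOfLength H 5) := by
  have hcl : ∀ a ∈ S, ∀ b, H.Adj a b → b ∈ S := by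
    intro a ha b hab
    rw [hS] at ha ⊢
    exact ha.trans hab.reachable
  have hsub : c.support.tail.toFinset ⊆ S := by
    intro x hx
    rw [hS]
    exact (c.takeUntil x (List.mem_of_mem_tail (List.mem_toFinset.1 hx))).reachable
  have hcard : c.support.tail.toFinset.card = c.length := by
    rw [List.toFinset_card_of_nodup hc.support_nodup]; simp
  have hle := Finset.card_le_card hsub
  refine ⟨by omega, fun hS5 => ?_⟩
  have heq := Finset.eq_of_subset_of_card_le hsub (by omega)
  have hsup : ∀ w, H.Reachable u w → w ∈ c.support := by
    intro w hw
    rw [← hS, ← heq] at hw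
    exact List.mem_of_mem_tail (List.mem_toFinset.1 hw)
  have hnb : ∀ w ∈ S, (c.toSubgraph.neighborSet w).ncard = 2 := fun w hw =>
    hc.ncard_neighborSet_toSubgraph_eq_two (hsup w ((hS w).1 hw))
  have hdeg : ∀ w, (H.neighborSet w).ncard = H.degree w := by
    intro w
    rw [← card_neighborFinset_eq_degree, ← Set.ncard_coe_finset, coe_neighborFinset]
  have hge : ∀ w ∈ S, 2 ≤ H.degree w := by
    intro w hw
    rw [← hdeg, ← hnb w hw]
    exact Set.ncard_le_ncard (c.toSubgraph.neighborSet_subset w) (Set.toFinite _)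
  have hle2 : ∀ w ∈ S, H.degree w ≤ 2 := by
    intro w hw
    have h := aux_moore H h3 h4 S hcl w hw
    have : ∑ x ∈ H.neighborFinset w, 2 ≤ ∑ x ∈ H.neighborFinset w, H.degree x :=
      Finset.sum_le_sum fun x hx => hge x (hcl w hw x (by simpa using hx))
    simp at this
    omega
  refine ⟨u, c, hc, by omega, hsup, ?_⟩
  rintro e he ⟨w, hwe, hw⟩
  obtain ⟨x, rfl⟩ := hwe
  have hwS := (hS w).2 hw
  have hN : c.toSubgraph.neighborSet w = H.neighborSet w :=
    Set.eq_of_subset_of_ncard_le (c.toSubgraph.neighborSet_subset w)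
      (by rw [hnb w hwS, hdeg]; exact hle2 w hwS) (Set.toFinite _)
  have hx : x ∈ c.toSubgraph.neighborSet w := by rw [hN]; exact he
  exact Walk.adj_toSubgraph_iff_mem_edges.1 hx

end aux

/-- In a finite connected cubic vertex-transitive graph of girth 5 on 10 or 12 vertices,
the removal of any cyclic edge-cut of cardinality 5 leaves a component which is a
cycle of length 5. -/
theorem cubic_girth_five_order_ten_or_twelve {V : Type*} [Fintype V]
    (G : SimpleGraph V) [DecidableRel G.Adj] (hconn : G.Connected)
    (hcubic : G.IsRegularOfDegree 3) (hvt : IsVertexTransitive G)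
    (hg : G.girth = 5) (hcard : Fintype.card V = 10 ∨ Fintype.card V = 12) :
    ∀ F : Set (Sym2 V), IsCyclicEdgeCut G F → F.ncard = 5 →
      HasCycleComponentOfLength (G.deleteEdges F) 5 := by
  classical
  intro F hF hF5
  obtain ⟨hFG, u, v, c, c', hc, hc', huv⟩ := hF
  have hle : G.deleteEdges F ≤ G := G.deleteEdges_le F
  have e1 : (G.deleteEdges F).edgeSet = G.edgeSet \ F := G.edgeSet_deleteEdges F
  generalize G.deleteEdges F = H at *
  have h3 : ∀ a b c, H.Adj a b → H.Adj b c → H.Adj a c → False :=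
    fun a b c h1 h2 h3 => aux_no3 G hg (hle h1) (hle h2) (hle h3)
  have h4 : ∀ a b c d, H.Adj a b → H.Adj b c → H.Adj a d → H.Adj d c → a ≠ c → b = d :=
    fun a b c d h1 h2 h3 h4 => aux_no4 G hg (hle h1) (hle h2) (hle h3) (hle h4)
  have hlen : ∀ {x : V} (p : H.Walk x x), p.IsCycle → 5 ≤ p.length := by
    intro x p hp
    have := aux_girth G hg _ (hp.mapLe hle)
    simpa using this
  let A : Finset V := Finset.univ.filter (fun w => H.Reachable u w)
  let B : Finset V := Finset.univ.filter (fun w => H.Reachable v w)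
  have hA : ∀ w, w ∈ A ↔ H.Reachable u w := by simp [A]
  have hB : ∀ w, w ∈ B ↔ H.Reachable v w := by simp [B]
  obtain ⟨hA5, hA'⟩ := aux_comp H h3 h4 A u hA c hc (hlen c hc)
  obtain ⟨hB5, hB'⟩ := aux_comp H h3 h4 B v hB c' hc' (hlen c' hc')
  by_cases hA6 : A.card = 5
  · exact hA' hA6
  by_cases hB6 : B.card = 5
  · exact hB' hB6
  exfalso
  have hdis : Disjoint A B := by
    rw [Finset.disjoint_left]
    intro x hx hx'
    exact huv (((hA x).1 hx).trans ((hB x).1 hx').symm)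
  have hcu := Finset.card_union_of_disjoint hdis
  have hcle := Finset.card_le_univ (A ∪ B)
  have hAc : A.card = 6 := by omega
  have hBc : B.card = 6 := by omega
  have huniv : A ∪ B = Finset.univ := Finset.eq_univ_of_card _ (by omega)
  have s1 := aux_six H h3 h4 A (fun a ha b hab => (hA b).2 (((hA a).1 ha).trans hab.reachable)) hAc
  have s2 := aux_six H h3 h4 B (fun a ha b hab => (hB b).2 (((hB a).1 ha).trans hab.reachable)) hBc
  have s3 : ∑ w, H.degree w = ∑ w ∈ A, H.degree w + ∑ w ∈ B, H.degree w := by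
    rw [← huniv, Finset.sum_union hdis]
  have s4 := H.sum_degrees_eq_twice_card_edges
  have s5 := G.sum_degrees_eq_twice_card_edges
  have s6 : ∑ w, G.degree w = 36 := by
    rw [Finset.sum_congr rfl (fun w _ => hcubic w)]
    simp; omega
  have s7 : G.edgeFinset.card ≤ H.edgeFinset.card + 5 := by
    have e2 := Set.ncard_le_ncard_sdiff_add_ncard G.edgeSet F (Set.toFinite _)
    rw [← e1, hF5, ← coe_edgeFinset G, ← coe_edgeFinset H, Set.ncard_coe_finset,
      Set.ncard_coe_finset] at e2
    exact e2
  omega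
end

section
/- Let G be a finite connected cubic vertex-transitive graph of girth 5. Then G is super cyclically edge-connected; that is, for every minimum cyclic edge-cut F of G, some component of G − F is a cycle of length 5. -/
open SimpleGraph

set_option linter.unusedSectionVars false
namespace CG
variable {V : Type*} [Fintype V] [DecidableEq V] (G : SimpleGraph V) [DecidableRel G.Adj]

/-- number of ordered adjacent pairs from S to T -/
def ee (S T : Finset V) : ℕ := ∑ u ∈ S, ∑ v ∈ T, if G.Adj u v then 1 else 0

/-- size of the edge boundary -/
def dd (S : Finset V) : ℕ := ee G S Sᶜ

lemma ee_comm (S T : Finset V) : ee G S T = ee G T S := by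
  unfold ee
  rw [Finset.sum_comm]
  simp [G.adj_comm]

lemma ee_union_left {S S' : Finset V} (T : Finset V) (h : Disjoint S S') :
    ee G (S ∪ S') T = ee G S T + ee G S' T := by
  unfold ee; rw [Finset.sum_union h]

lemma ee_union_right {S S' : Finset V} (T : Finset V) (h : Disjoint S S') :
    ee G T (S ∪ S') = ee G T S + ee G T S' := by
  rw [ee_comm, ee_union_left G T h, ee_comm, ee_comm G S']

lemma dd_compl (S : Finset V) : dd G Sᶜ = dd G S := by
  unfold dd; rw [compl_compl, ee_comm]

lemma ee_univ (h3 : G.IsRegularOfDegree 3) (S : Finset V) : ee G S Finset.univ = 3 * S.card := by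
  unfold ee
  have : ∀ u ∈ S, (∑ v, if G.Adj u v then 1 else 0) = 3 := by
    intro u _
    rw [← h3 u, ← G.card_neighborFinset_eq_degree, G.neighborFinset_eq_filter]
    simp
  rw [Finset.sum_congr rfl this]; simp [mul_comm]

lemma dd_add (h3 : G.IsRegularOfDegree 3) (S : Finset V) : ee G S S + dd G S = 3 * S.card := by
  unfold dd
  rw [← ee_univ G h3, ← ee_union_right G S disjoint_compl_right, Finset.union_compl]

lemma ee_single (x : V) (S : Finset V) : ee G {x} S = (S.filter (G.Adj x)).card := by
  simp [ee]

lemma ee_even (S : Finset V) : Even (ee G S S) := by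
  induction S using Finset.induction_on with
  | empty => simp [ee]
  | insert x S hx ih =>
    have hd : Disjoint {x} S := by simpa using hx
    rw [Finset.insert_eq, ee_union_left G _ hd, ee_union_right G _ hd, ee_union_right G _ hd,
      ee_comm G S {x}]
    have : ee G {x} {x} = 0 := by simp [ee]
    rw [this]
    rcases ih with ⟨r, hr⟩
    exact ⟨r + ee G {x} S, by omega⟩

lemma dd_parity (h3 : G.IsRegularOfDegree 3) (S : Finset V) : dd G S % 2 = S.card % 2 := by
  have := dd_add G h3 S
  obtain ⟨r, hr⟩ := ee_even G S
  omega

lemma uncross (A B : Finset V) :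
    dd G (A ∩ B) + dd G (A ∪ B) + 2 * ee G (A \ B) (B \ A) = dd G A + dd G B := by
  have eA : dd G A = ee G ((A ∩ B) ∪ (A \ B)) ((B \ A) ∪ (A ∪ B)ᶜ) := by
    unfold dd; congr 1 <;> (ext; simp; try tauto)
  have eB : dd G B = ee G ((A ∩ B) ∪ (B \ A)) ((A \ B) ∪ (A ∪ B)ᶜ) := by
    unfold dd; congr 1 <;> (ext; simp; try tauto)
  have eI : dd G (A ∩ B) = ee G (A ∩ B) ((A \ B) ∪ ((B \ A) ∪ (A ∪ B)ᶜ)) := by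
    unfold dd; congr 1; ext; simp; try tauto
  have eU : dd G (A ∪ B) = ee G ((A ∩ B) ∪ ((A \ B) ∪ (B \ A))) (A ∪ B)ᶜ := by
    unfold dd; congr 1 <;> (ext; simp; try tauto)
  have d1 : Disjoint (A ∩ B) (A \ B) := by
    rw [Finset.disjoint_left]; intro x; simp; tauto
  have d2 : Disjoint (A ∩ B) (B \ A) := by
    rw [Finset.disjoint_left]; intro x; simp; tauto
  have d3 : Disjoint (B \ A) (A ∪ B)ᶜ := by
    rw [Finset.disjoint_left]; intro x; simp; tauto
  have d4 : Disjoint (A \ B) (A ∪ B)ᶜ := by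
    rw [Finset.disjoint_left]; intro x; simp; tauto
  have d7 : Disjoint (A \ B) (B \ A) := by
    rw [Finset.disjoint_left]; intro x; simp; tauto
  rw [eA, eB, eI, eU]
  generalize (A ∪ B)ᶜ = O at *
  generalize A ∩ B = I at *
  generalize A \ B = D at *
  generalize B \ A = E at *
  rw [ee_union_right G _ (Finset.disjoint_union_right.2 ⟨d7, d4⟩),
    ee_union_left G _ (Finset.disjoint_union_right.2 ⟨d1, d2⟩),
    ee_union_left G _ d1, ee_union_left G _ d2, ee_union_left G _ d7]
  simp only [ee_union_right G _ d3, ee_union_right G _ d4]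
  rw [ee_comm G E D]
  ring

lemma uncross' (A B : Finset V) :
    dd G (A \ B) + dd G (B \ A) ≤ dd G A + dd G B := by
  have h := uncross G A Bᶜ
  have h1 : A ∩ Bᶜ = A \ B := by ext; simp
  have h2 : A ∪ Bᶜ = (B \ A)ᶜ := by ext; simp; tauto
  rw [h1, h2, dd_compl, dd_compl] at h
  omega

/-- uncrossing at threshold t -/
lemma uncross_t {k t : ℕ} (hk : ∀ S : Finset V, t ≤ S.card → t ≤ Sᶜ.card → k ≤ dd G S)
    {A B : Finset V} (hA : dd G A = k) (hB : dd G B = k) (hAB : A.card = B.card)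
    (hh : A.card ≤ Aᶜ.card) :
    (t ≤ (A ∩ B).card → dd G (A ∩ B) = k ∧ ee G (A \ B) (B \ A) = 0) ∧
    (t ≤ (A \ B).card → dd G (A \ B) = k) := by
  have c1 := Finset.card_inter_add_card_sdiff A B
  have c1' := Finset.card_inter_add_card_sdiff B A
  rw [Finset.inter_comm] at c1'
  have c2 := Finset.card_union_add_card_inter A B
  have c3 := Finset.card_compl_add_card A
  have c4 := Finset.card_compl_add_card (A ∪ B)
  have c5 := Finset.card_compl_add_card (A ∩ B)
  have c6 := Finset.card_compl_add_card (A \ B)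
  have c7 := Finset.card_compl_add_card (B \ A)
  have u1 := uncross G A B
  have u2 := uncross' G A B
  constructor
  · intro h
    have := hk (A ∩ B) h (by omega)
    have := hk (A ∪ B) (by omega) (by omega)
    omega
  · intro h
    have := hk (A \ B) h (by omega)
    have := hk (B \ A) (by omega) (by omega)
    omega

lemma ee_image (φ : G ≃g G) (S T : Finset V) :
    ee G (S.image φ) (T.image φ) = ee G S T := by
  unfold ee
  rw [Finset.sum_image (by intro x _ y _ h; exact φ.injective h)]
  refine Finset.sum_congr rfl fun u _ => ?_
  rw [Finset.sum_image (by intro x _ y _ h; exact φ.injective h)]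
  refine Finset.sum_congr rfl fun v _ => ?_
  have : G.Adj (φ u) (φ v) ↔ G.Adj u v := φ.map_rel_iff
  simp only [this]

lemma compl_image (φ : G ≃g G) (S : Finset V) : (S.image φ)ᶜ = Sᶜ.image φ := by
  ext x
  obtain ⟨y, rfl⟩ := φ.surjective x
  simp

lemma dd_image (φ : G ≃g G) (S : Finset V) : dd G (S.image φ) = dd G S := by
  unfold dd; rw [compl_image, ee_image]

lemma card_image (φ : G ≃g G) (S : Finset V) : (S.image φ).card = S.card :=
  Finset.card_image_of_injective _ φ.injective

lemma block (hvt : ∀ x y : V, ∃ φ : G ≃g G, φ x = y) {A : Finset V} (hne : A.Nonempty)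
    (hb : ∀ φ : G ≃g G, A ∩ A.image φ = ∅ ∨ A ∩ A.image φ = A) : ∃ c, dd G A = A.card * c := by
  obtain ⟨x, hx⟩ := hne
  refine ⟨ee G {x} Aᶜ, ?_⟩
  have key : ∀ y ∈ A, (∑ v ∈ Aᶜ, if G.Adj y v then 1 else 0) = ee G {x} Aᶜ := by
    intro y hy
    obtain ⟨φ, hφ⟩ := hvt x y
    have hyi : y ∈ A.image φ := Finset.mem_image.2 ⟨x, hx, hφ⟩
    have hAφ : A.image φ = A := by
      rcases hb φ with h | h
      · have : y ∈ A ∩ A.image φ := Finset.mem_inter.2 ⟨hy, hyi⟩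
        simp [h] at this
      · symm
        refine Finset.eq_of_subset_of_card_le (Finset.inter_eq_left.1 h) ?_
        rw [card_image]
    rw [← ee_image G φ, ← compl_image, hAφ]
    simp [ee, hφ]
  unfold dd
  conv_lhs => unfold ee
  rw [Finset.sum_congr rfl key]; simp

lemma dd_pos (hc : G.Connected) {A : Finset V} (h1 : A.Nonempty) (h2 : Aᶜ.Nonempty) :
    dd G A ≠ 0 := by
  obtain ⟨x, hx⟩ := h1
  obtain ⟨y, hy⟩ := h2
  intro h0
  have hn : ∀ u ∈ A, ∀ v, G.Adj u v → v ∈ A := by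
    intro u hu v huv
    by_contra hv
    simp only [dd, ee, Finset.sum_eq_zero_iff] at h0
    have := h0 u hu v (by simpa using hv)
    simp [huv] at this
  obtain ⟨w⟩ := hc.preconnected x y
  have : ∀ {a b : V} (w : G.Walk a b), a ∈ A → b ∈ A := by
    intro a b w
    induction w with
    | nil => exact id
    | cons h p ih => intro ha; exact ih (hn _ ha _ h)
  have := this w hx
  simp at hy; exact hy this

end CG
namespace CG
variable {V : Type*} [Fintype V] [DecidableEq V] (G : SimpleGraph V) [DecidableRel G.Adj]

lemma nb (h3 : G.IsRegularOfDegree 3) (v : V) : ∃ a b c, a ≠ b ∧ a ≠ c ∧ b ≠ c ∧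
    ∀ x, G.Adj v x ↔ x = a ∨ x = b ∨ x = c := by
  have := h3 v
  rw [← G.card_neighborFinset_eq_degree, Finset.card_eq_three] at this
  obtain ⟨a, b, c, h1, h2, h3, h⟩ := this
  refine ⟨a, b, c, h1, h2, h3, fun x => ?_⟩
  rw [← G.mem_neighborFinset, h]; simp

/-- the third neighbour -/
lemma third (h3 : G.IsRegularOfDegree 3) {v a b : V} (ha : G.Adj v a) (hb : G.Adj v b)
    (hab : a ≠ b) : ∃ c, G.Adj v c ∧ c ≠ a ∧ c ≠ b ∧ ∀ x, G.Adj v x → x = a ∨ x = b ∨ x = c := by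
  obtain ⟨p, q, r, h1, h2, h3, h⟩ := nb G h3 v
  simp only [h] at *
  rcases ha with rfl | rfl | rfl <;> rcases hb with rfl | rfl | rfl <;> first | exact absurd rfl hab | skip
  · exact ⟨r, by tauto, by tauto, by tauto, by tauto⟩
  · exact ⟨q, by tauto, by tauto, by tauto, by tauto⟩
  · exact ⟨r, by tauto, by tauto, by tauto, by tauto⟩
  · exact ⟨p, by tauto, by tauto, by tauto, by tauto⟩
  · exact ⟨q, by tauto, by tauto, by tauto, by tauto⟩
  · exact ⟨p, by tauto, by tauto, by tauto, by tauto⟩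

lemma all3 (h3 : G.IsRegularOfDegree 3) {v a b c : V} (ha : G.Adj v a) (hb : G.Adj v b)
    (hc : G.Adj v c) (hab : a ≠ b) (hac : a ≠ c) (hbc : b ≠ c) :
    ∀ x, G.Adj v x → x = a ∨ x = b ∨ x = c := by
  obtain ⟨d, h1, h2, h3, h4⟩ := third G h3 ha hb hab
  rcases h4 c hc with h | h | h
  · exact absurd h.symm hac
  · exact absurd h.symm hbc
  · subst h; exact h4

/-- No triangles, no 4-cycles -/
structure NC : Prop where
  tri : ∀ {a b c}, G.Adj a b → G.Adj b c → G.Adj c a → False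
  c4 : ∀ {a b c d}, G.Adj a b → G.Adj b c → G.Adj c d → G.Adj d a → a ≠ c → b ≠ d → False

structure Theta (m a b p q r s : V) : Prop where
  ma : G.Adj m a
  mb : G.Adj m b
  ap : G.Adj a p
  pq : G.Adj p q
  qb : G.Adj q b
  ar : G.Adj a r
  rs : G.Adj r s
  sb : G.Adj s b
  nd : [m, a, b, p, q, r, s].Nodup

/-- minimal inner degree two -/
lemma two_nb (h3 : G.IsRegularOfDegree 3)
    (hQ : ∀ S : Finset V, 4 ≤ S.card → 4 ≤ Sᶜ.card → 5 ≤ dd G S)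
    {S : Finset V} (h5 : 5 ≤ S.card) (hc : 4 ≤ Sᶜ.card) (hd : dd G S = 5) {x : V} (hx : x ∈ S) :
    ∃ y z, y ∈ S ∧ z ∈ S ∧ y ≠ z ∧ G.Adj x y ∧ G.Adj x z := by
  by_contra hno
  have hle : ee G {x} S ≤ 1 := by
    rw [ee_single, Finset.card_le_one]
    intro a ha b hb
    by_contra hab
    simp at ha hb
    exact hno ⟨a, b, ha.1, hb.1, hab, ha.2, hb.2⟩
  have hd' : Disjoint {x} (S.erase x) := by simp
  have hS : {x} ∪ S.erase x = S := by rw [← Finset.insert_eq, Finset.insert_erase hx]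
  have e1 : ee G S S = ee G {x} (S.erase x) + ee G {x} (S.erase x) + ee G (S.erase x) (S.erase x) := by
    have h := ee_union_left G S hd'
    rw [hS] at h
    rw [h]
    have h1 := ee_union_right G {x} hd'
    have h2 := ee_union_right G (S.erase x) hd'
    rw [hS] at h1 h2
    rw [h1, h2, ee_comm G (S.erase x) {x}]
    have : ee G {x} {x} = 0 := by simp [ee]
    omega
  have e2 : ee G {x} S = ee G {x} (S.erase x) := by
    have h1 := ee_union_right G {x} hd'
    rw [hS] at h1
    have : ee G {x} {x} = 0 := by simp [ee]
    omega
  have a1 := dd_add G h3 S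
  have a2 := dd_add G h3 (S.erase x)
  have c1 := Finset.card_erase_of_mem hx
  have c2 := Finset.card_compl_add_card S
  have c3 := Finset.card_compl_add_card (S.erase x)
  have := hQ (S.erase x) (by omega) (by omega)
  omega

/-- intersections of 7-sets -/
lemma inter7 (h3 : G.IsRegularOfDegree 3)
    (hQ : ∀ S : Finset V, 4 ≤ S.card → 4 ≤ Sᶜ.card → 5 ≤ dd G S) (hn : 14 ≤ Fintype.card V)
    {A B : Finset V} (cA : A.card = 7) (cB : B.card = 7) (hA : dd G A = 5) (hB : dd G B = 5)
    (h : 3 ≤ (A ∩ B).card) :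
    A = B ∨ ((A ∩ B).card = 5 ∧ dd G (A ∩ B) = 5 ∧ ee G (A \ B) (B \ A) = 0) := by
  have c3 := Finset.card_compl_add_card A
  obtain ⟨u1, u2⟩ := uncross_t G hQ hA hB (by omega) (by omega)
  have c1 := Finset.card_inter_add_card_sdiff A B
  have p1 := dd_parity G h3 (A ∩ B)
  have p2 := dd_parity G h3 (A \ B)
  by_cases h4 : 4 ≤ (A ∩ B).card
  · obtain ⟨v1, v2⟩ := u1 h4
    by_cases h7 : (A ∩ B).card = 7
    · left
      have e1 : A ∩ B = A := Finset.eq_of_subset_of_card_le Finset.inter_subset_left (by omega)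
      have e2 : A ∩ B = B := Finset.eq_of_subset_of_card_le Finset.inter_subset_right (by omega)
      rw [← e1]; exact e2
    · right; refine ⟨by omega, v1, v2⟩
  · have := u2 (by omega)
    omega

end CG
namespace CG
variable {V : Type*} [Fintype V] [DecidableEq V] (G : SimpleGraph V) [DecidableRel G.Adj]

lemma pent (nc : NC G) {P : Finset V} (hc : P.card = 5)
    (h2 : ∀ x ∈ P, ∃ y z, y ∈ P ∧ z ∈ P ∧ y ≠ z ∧ G.Adj x y ∧ G.Adj x z) {v : V} (hv : v ∈ P) :
    ∃ u w u' w', G.Adj v u ∧ G.Adj v w ∧ G.Adj u u' ∧ G.Adj w w' ∧ G.Adj u' w' ∧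
      [v, u, w, u', w'].Nodup ∧ P = [v, u, w, u', w'].toFinset := by
  have other : ∀ x ∈ P, ∀ t, ∃ y ∈ P, y ≠ t ∧ G.Adj x y := by
    intro x hx t
    obtain ⟨y, z, hy, hz, hyz, h1, h2⟩ := h2 x hx
    by_cases h : y = t
    · exact ⟨z, hz, by rw [← h]; exact hyz.symm, h2⟩
    · exact ⟨y, hy, h, h1⟩
  obtain ⟨u, w, hu, hw, huw, avu, avw⟩ := h2 v hv
  obtain ⟨u', hu', hu'v, auu⟩ := other u hu v
  obtain ⟨w', hw', hw'v, aww⟩ := other w hw v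
  have n1 : v ≠ u := avu.ne
  have n2 : v ≠ w := avw.ne
  have n3 : u ≠ u' := auu.ne
  have n4 : w ≠ w' := aww.ne
  have n5 : u' ≠ w := by rintro rfl; exact nc.tri avu auu avw.symm
  have n6 : w' ≠ u := by rintro rfl; exact nc.tri avw aww avu.symm
  have n7 : u' ≠ w' := by rintro rfl; exact nc.c4 avu auu aww.symm avw.symm hu'v.symm huw
  have nd : [v, u, w, u', w'].Nodup := by
    simp only [List.nodup_cons, List.mem_cons, List.not_mem_nil, or_false, not_or]
    refine ⟨⟨n1, n2, hu'v.symm, hw'v.symm⟩, ⟨huw, n3, n6.symm⟩, ⟨n5.symm, n4⟩, n7, by simp⟩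
  have hP : [v, u, w, u', w'].toFinset = P := by
    apply Finset.eq_of_subset_of_card_le
    · intro x hx; simp at hx; rcases hx with rfl | rfl | rfl | rfl | rfl <;> assumption
    · rw [List.toFinset_card_of_nodup nd, hc]; simp
  refine ⟨u, w, u', w', avu, avw, auu, aww, ?_, nd, hP.symm⟩
  obtain ⟨z, hz, hzu, az⟩ := other u' hu' u
  rw [← hP] at hz
  simp at hz
  rcases hz with rfl | rfl | rfl | rfl | rfl
  · exact (nc.tri avu auu az).elim
  · exact absurd rfl hzu
  · exact (nc.c4 avu auu az avw.symm hu'v.symm huw).elim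
  · exact (az.ne rfl).elim
  · exact az

lemma mk_theta (nc : NC G) {A P : Finset V} (hPA : P ⊆ A) (cA : A.card = 7) (hc : P.card = 5)
    (h2 : ∀ x ∈ P, ∃ y z, y ∈ P ∧ z ∈ P ∧ y ≠ z ∧ G.Adj x y ∧ G.Adj x z)
    (h2A : ∀ x ∈ A, ∃ y z, y ∈ A ∧ z ∈ A ∧ y ≠ z ∧ G.Adj x y ∧ G.Adj x z) :
    ∃ m a b p q r s, Theta G m a b p q r s ∧ [m, a, b, p, q, r, s].toFinset = A := by
  have hD : (A \ P).card = 2 := by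
    rw [Finset.card_sdiff_of_subset hPA]; omega
  obtain ⟨x, y, hxy, hD⟩ := Finset.card_eq_two.1 hD
  have memA : ∀ z, z ∈ A → z ∉ P → z = x ∨ z = y := by
    intro z h1 h2
    have : z ∈ A \ P := Finset.mem_sdiff.2 ⟨h1, h2⟩
    rw [hD] at this; simpa using this
  have hx : x ∈ A \ P := by rw [hD]; simp
  have hy : y ∈ A \ P := by rw [hD]; simp
  rw [Finset.mem_sdiff] at hx hy
  -- at most one neighbour in P
  have one : ∀ z, z ∉ P → ∀ d d', d ∈ P → d' ∈ P → G.Adj z d → G.Adj z d' → d = d' := by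
    intro z hz d d' hd hd' h1 h2'
    by_contra hne
    obtain ⟨u, w, u', w', a1, a2, a3, a4, a5, nd, hP⟩ := pent G nc hc h2 hd
    rw [hP] at hd' hz
    simp at hd' hz
    obtain ⟨z1, z2, z3, z4, z5⟩ := hz
    rcases hd' with rfl | rfl | rfl | rfl | rfl
    · exact hne rfl
    · exact nc.tri h1 a1 h2'.symm
    · exact nc.tri h1 a2 h2'.symm
    · exact nc.c4 h1 a1 a3 h2'.symm z2 hne
    · exact nc.c4 h1 a2 a4 h2'.symm z3 hne
  have att : ∀ x y, x ∈ A → x ∉ P → (∀ z, z ∈ A → z ∉ P → z = x ∨ z = y) →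
      G.Adj x y ∧ ∃ d ∈ P, G.Adj x d := by
    intro x y h1 h2 hm
    obtain ⟨f, g, hf, hg, hfg, af, ag⟩ := h2A x h1
    by_cases fP : f ∈ P
    · by_cases gP : g ∈ P
      · exact absurd (one x h2 f g fP gP af ag) hfg
      · rcases hm g hg gP with rfl | rfl
        · exact absurd rfl ag.ne
        · exact ⟨ag, f, fP, af⟩
    · rcases hm f hf fP with rfl | rfl
      · exact absurd rfl af.ne
      · by_cases gP : g ∈ P
        · exact ⟨af, g, gP, ag⟩
        · rcases hm g hg gP with rfl | rfl
          · exact absurd rfl ag.ne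
          · exact absurd rfl hfg
  obtain ⟨axy, d, hd, axd⟩ := att x y hx.1 hx.2 memA
  obtain ⟨-, d', hd', ayd⟩ := att y x hy.1 hy.2 (fun z h1 h2 => (memA z h1 h2).symm)
  obtain ⟨u, w, u', w', a1, a2, a3, a4, a5, nd, hP⟩ := pent G nc hc h2 hd
  have hxP := hx.2
  have hyP := hy.2
  have hAU : A = insert x (insert y P) := by
    ext z
    simp only [Finset.mem_insert]
    constructor
    · intro hz
      by_cases hzP : z ∈ P
      · tauto
      · have := memA z hz hzP; tauto
    · rintro (rfl | rfl | h)
      · exact hx.1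
      · exact hy.1
      · exact hPA h
  rw [hP] at hd' hxP hyP
  simp only [List.mem_toFinset, List.mem_cons, List.not_mem_nil, or_false, not_or] at hd' hxP hyP
  simp only [List.nodup_cons, List.mem_cons, List.not_mem_nil, or_false, not_or] at nd
  rcases hd' with rfl | rfl | rfl | rfl | rfl
  · exact (nc.tri axy ayd axd.symm).elim
  · exact (nc.c4 axy ayd a1.symm axd.symm hxP.2.1 hyP.1).elim
  · exact (nc.c4 axy ayd a2.symm axd.symm hxP.2.2.1 hyP.1).elim
  · refine ⟨u, d, d', x, y, w, w', ⟨a1.symm, a3, axd.symm, axy, ayd, a2, a4, a5.symm, ?_⟩, ?_⟩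
    · simp only [List.nodup_cons, List.mem_cons, List.not_mem_nil, or_false, not_or]
      grind
    · rw [hAU, hP]; ext z; simp; grind
  · refine ⟨w, d, d', x, y, u, u', ⟨a2.symm, a4, axd.symm, axy, ayd, a1, a3, a5, ?_⟩, ?_⟩
    · simp only [List.nodup_cons, List.mem_cons, List.not_mem_nil, or_false, not_or]
      grind
    · rw [hAU, hP]; ext z; simp; grind

variable {G}
lemma Theta.map {m a b p q r s : V} (h : Theta G m a b p q r s) (φ : G ≃g G) :
    Theta G (φ m) (φ a) (φ b) (φ p) (φ q) (φ r) (φ s) := by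
  have t : ∀ {x y}, G.Adj x y → G.Adj (φ x) (φ y) := fun h => φ.map_rel_iff.2 h
  refine ⟨t h.ma, t h.mb, t h.ap, t h.pq, t h.qb, t h.ar, t h.rs, t h.sb, ?_⟩
  exact h.nd.map φ.injective

lemma Theta.swap1 {m a b p q r s : V} (h : Theta G m a b p q r s) : Theta G m a b r s p q := by
  refine ⟨h.ma, h.mb, h.ar, h.rs, h.sb, h.ap, h.pq, h.qb, ?_⟩
  have := h.nd
  simp only [List.nodup_cons, List.mem_cons, List.not_mem_nil, or_false, not_or] at this ⊢
  grind

lemma Theta.swap2 {m a b p q r s : V} (h : Theta G m a b p q r s) : Theta G m b a q p s r := by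
  refine ⟨h.mb, h.ma, h.qb.symm, h.pq.symm, h.ap.symm, h.sb.symm, h.rs.symm, h.ar.symm, ?_⟩
  have := h.nd
  simp only [List.nodup_cons, List.mem_cons, List.not_mem_nil, or_false, not_or] at this ⊢
  grind

lemma Theta.ca {m a b p q r s : V} (h : Theta G m a b p q r s) :
    ([m, a, b, p, q, r, s].toFinset).card = 7 := by
  rw [List.toFinset_card_of_nodup h.nd]; rfl

lemma sw1 {m a b p q r s : V} : [m, a, b, r, s, p, q].toFinset = [m, a, b, p, q, r, s].toFinset := by
  ext z; simp; grind
lemma sw2 {m a b p q r s : V} : [m, b, a, q, p, s, r].toFinset = [m, a, b, p, q, r, s].toFinset := by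
  ext z; simp; grind

end CG
namespace CG
variable {V : Type*} [Fintype V] [DecidableEq V] {G : SimpleGraph V} [DecidableRel G.Adj]

lemma stepB (h3 : G.IsRegularOfDegree 3) (nc : NC G)
    (hQ : ∀ S : Finset V, 4 ≤ S.card → 4 ≤ Sᶜ.card → 5 ≤ dd G S) (hn : 14 ≤ Fintype.card V)
    {m a b p q r s p2 q2 r2 s2 : V} (t : Theta G m a b p q r s)
    (d1 : dd G [m, a, b, p, q, r, s].toFinset = 5) (t2 : Theta G a p r p2 q2 r2 s2)
    (d2 : dd G [a, p, r, p2, q2, r2, s2].toFinset = 5) : False := by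
  have nd := t.nd
  have nd2 := t2.nd
  simp only [List.nodup_cons, List.mem_cons, List.not_mem_nil, or_false, not_or] at nd nd2
  have hq : q = p2 ∨ q = r2 := by
    rcases all3 G h3 t2.ma.symm t2.ap t2.ar (by grind) (by grind) (by grind) q t.pq with h | h | h
    · exact absurd h.symm (by grind)
    · exact Or.inl h
    · exact Or.inr h
  have hb : b ∉ [a, p, r, p2, q2, r2, s2].toFinset := by
    simp only [List.mem_toFinset, List.mem_cons, List.not_mem_nil, or_false, not_or]
    refine ⟨by grind, by grind, by grind, ?_, ?_, ?_, ?_⟩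
    · rintro rfl; exact nc.tri t.pq t.qb t2.ap.symm
    · rintro rfl; exact nc.tri t.rs t.sb t2.qb
    · rintro rfl; exact nc.tri t.pq t.qb t2.ar.symm
    · rintro rfl; exact nc.tri t.rs t.sb t2.sb
  have hI : [a, p, r].toFinset ⊆
      [m, a, b, p, q, r, s].toFinset ∩ [a, p, r, p2, q2, r2, s2].toFinset := by
    intro z hz; simp at hz ⊢; grind
  have cI := Finset.card_le_card hI
  rw [List.toFinset_card_of_nodup (by simp; grind)] at cI
  rcases inter7 G h3 hQ hn t.ca t2.ca d1 d2 cI with h | ⟨h5, hd, -⟩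
  · rw [← h] at hb; simp at hb
  · have hqI : q ∈ [m, a, b, p, q, r, s].toFinset ∩ [a, p, r, p2, q2, r2, s2].toFinset := by
      simp only [Finset.mem_inter, List.mem_toFinset, List.mem_cons]; grind
    have cc := Finset.card_compl_add_card
      ([m, a, b, p, q, r, s].toFinset ∩ [a, p, r, p2, q2, r2, s2].toFinset)
    obtain ⟨y, z, hy, hz, hyz, ay, az⟩ := two_nb G h3 hQ (by omega) (by omega) hd hqI
    have key : ∀ z, z ∈ [m, a, b, p, q, r, s].toFinset ∩ [a, p, r, p2, q2, r2, s2].toFinset →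
        G.Adj q z → z = p := by
      intro z hz az
      rw [Finset.mem_inter] at hz
      obtain ⟨hz1, hz2⟩ := hz
      simp only [List.mem_toFinset, List.mem_cons, List.not_mem_nil, or_false] at hz1
      rcases hz1 with rfl | rfl | rfl | rfl | rfl | rfl | rfl
      · exact (nc.tri az t.mb t.qb.symm).elim
      · exact (nc.tri t.ap t.pq az).elim
      · exact absurd hz2 hb
      · rfl
      · exact absurd rfl az.ne
      · exact (nc.c4 t.ap t.pq az t.ar.symm (by grind) (by grind)).elim
      · exact (nc.tri az t.sb t.qb.symm).elim
    exact hyz ((key y hy ay).trans (key z hz az).symm)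

/-- conclusion of the step -/
def Next (G : SimpleGraph V) [DecidableRel G.Adj] (m a b p q m' p' : V) : Prop :=
  G.Adj m m' ∧ G.Adj m' p' ∧ G.Adj p p' ∧ [a, m, p, b, q, m', p'].Nodup ∧
    dd G [a, m, p, b, q, m', p'].toFinset = 5

lemma stepA' (nc : NC G)
    {m a b p q r s q2 r2 s2 : V} (t : Theta G m a b p q r s) (t2 : Theta G a m p b q2 r2 s2)
    (d2 : dd G [a, m, p, b, q2, r2, s2].toFinset = 5) : Next G m a b p q r2 s2 := by
  have nd := t.nd
  simp only [List.nodup_cons, List.mem_cons, List.not_mem_nil, or_false, not_or] at nd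
  have : q2 = q := by
    by_contra hne
    exact nc.c4 t2.pq t2.qb t.pq t.qb (by grind) hne
  subst this
  exact ⟨t2.ar, t2.rs, t2.sb.symm, t2.nd, d2⟩

lemma stepA (h3 : G.IsRegularOfDegree 3) (nc : NC G)
    {m a b p q r s p2 q2 r2 s2 : V} (t : Theta G m a b p q r s) (t2 : Theta G a m p p2 q2 r2 s2)
    (d2 : dd G [a, m, p, p2, q2, r2, s2].toFinset = 5) : ∃ m' p', Next G m a b p q m' p' := by
  have nd := t.nd
  have nd2 := t2.nd
  simp only [List.nodup_cons, List.mem_cons, List.not_mem_nil, or_false, not_or] at nd nd2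
  rcases all3 G h3 t2.ma.symm t2.ap t2.ar (by grind) (by grind) (by grind) b t.mb with h | h | h
  · exact absurd h.symm (by grind)
  · subst h; exact ⟨_, _, stepA' nc t t2 d2⟩
  · subst h; exact ⟨_, _, stepA' nc t t2.swap1 (by rw [sw1]; exact d2)⟩

lemma step (h3 : G.IsRegularOfDegree 3) (nc : NC G) (hvt : ∀ x y : V, ∃ φ : G ≃g G, φ x = y)
    (hQ : ∀ S : Finset V, 4 ≤ S.card → 4 ≤ Sᶜ.card → 5 ≤ dd G S) (hn : 14 ≤ Fintype.card V)
    {m a b p q r s : V} (t : Theta G m a b p q r s)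
    (d1 : dd G [m, a, b, p, q, r, s].toFinset = 5) :
    ∃ m' p', Next G m a b p q m' p' ∨ Next G m a b r s m' p' := by
  have key : ∃ x y p2 q2 r2 s2, Theta G a x y p2 q2 r2 s2 ∧
      dd G [a, x, y, p2, q2, r2, s2].toFinset = 5 := by
    obtain ⟨φ, hφ⟩ := hvt m a
    refine ⟨φ a, φ b, φ p, φ q, φ r, φ s, hφ ▸ t.map φ, ?_⟩
    rw [← d1, ← dd_image G φ [m, a, b, p, q, r, s].toFinset, ← hφ]
    congr 1
    ext z; simp
  obtain ⟨x, y, p2, q2, r2, s2, t2, d2⟩ := key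
  have d1' := d1
  rw [← sw1] at d1'
  have d2' := d2
  rw [← sw2] at d2'
  have nd := t.nd
  have nd2 := t2.nd
  simp only [List.nodup_cons, List.mem_cons, List.not_mem_nil, or_false, not_or] at nd nd2
  have al := all3 G h3 t.ma.symm t.ap t.ar (by grind) (by grind) (by grind)
  have hxy : x ≠ y := by grind
  rcases al x t2.ma with rfl | rfl | rfl <;> rcases al y t2.mb with rfl | rfl | rfl
  · exact absurd rfl hxy
  · obtain ⟨m', p', h⟩ := stepA h3 nc t t2 d2; exact ⟨m', p', Or.inl h⟩
  · obtain ⟨m', p', h⟩ := stepA h3 nc t.swap1 t2 d2; exact ⟨m', p', Or.inr h⟩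
  · obtain ⟨m', p', h⟩ := stepA h3 nc t t2.swap2 d2'; exact ⟨m', p', Or.inl h⟩
  · exact absurd rfl hxy
  · exact (stepB h3 nc hQ hn t d1 t2 d2).elim
  · obtain ⟨m', p', h⟩ := stepA h3 nc t.swap1 t2.swap2 d2'; exact ⟨m', p', Or.inr h⟩
  · exact (stepB h3 nc hQ hn t.swap1 d1' t2 d2).elim
  · exact absurd rfl hxy

lemma fin1 (h3 : G.IsRegularOfDegree 3) (nc : NC G)
    (hQ : ∀ S : Finset V, 4 ≤ S.card → 4 ≤ Sᶜ.card → 5 ≤ dd G S) (hn : 14 ≤ Fintype.card V)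
    {m a b p q r s m' p' q' : V} (t : Theta G m a b p q r s)
    (h1 : Next G m a b p q m' p') (h2 : Next G m b a q p m' q') : False := by
  obtain ⟨-, -, h1c, h1d, h1e⟩ := h1
  obtain ⟨-, -, h2c, h2d, h2e⟩ := h2
  have c1 := List.toFinset_card_of_nodup h1d
  have c2 := List.toFinset_card_of_nodup h2d
  simp only [List.length_cons, List.length_nil] at c1 c2
  have hI : [a, m, p, b, q, m'].toFinset ⊆
      [a, m, p, b, q, m', p'].toFinset ∩ [b, m, q, a, p, m', q'].toFinset := by
    intro z hz; simp at hz ⊢; grind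
  have cI := Finset.card_le_card hI
  simp only [List.nodup_cons, List.mem_cons, List.not_mem_nil, or_false, not_or] at h1d h2d
  rw [List.toFinset_card_of_nodup (by
    simp only [List.nodup_cons, List.mem_cons, List.not_mem_nil, or_false, not_or]; grind)] at cI
  simp only [List.length_cons, List.length_nil] at cI
  rcases inter7 G h3 hQ hn c1 c2 h1e h2e (by omega) with h | ⟨h5, -, -⟩
  · have : p' ∈ [a, m, p, b, q, m', p'].toFinset := by simp
    rw [h] at this
    simp only [List.mem_toFinset, List.mem_cons, List.not_mem_nil, or_false] at this
    have : p' = q' := by grind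
    subst this
    exact nc.tri t.pq h2c h1c.symm
  · omega

lemma fin2 (h3 : G.IsRegularOfDegree 3) (nc : NC G)
    (hQ : ∀ S : Finset V, 4 ≤ S.card → 4 ≤ Sᶜ.card → 5 ≤ dd G S) (hn : 14 ≤ Fintype.card V)
    {m a b p q r s m' p' s' : V} (t : Theta G m a b p q r s)
    (d1 : dd G [m, a, b, p, q, r, s].toFinset = 5)
    (h1 : Next G m a b p q m' p') (h2 : Next G m b a s r m' s') : False := by
  obtain ⟨h1a, -, h1c, h1d, h1e⟩ := h1
  obtain ⟨-, -, h2c, h2d, h2e⟩ := h2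
  have nd := t.nd
  have c1 := List.toFinset_card_of_nodup h1d
  have c2 := List.toFinset_card_of_nodup h2d
  simp only [List.length_cons, List.length_nil] at c1 c2
  simp only [List.nodup_cons, List.mem_cons, List.not_mem_nil, or_false, not_or] at h1d h2d nd
  have rp' : r ≠ p' := by rintro rfl; exact nc.tri t.ap h1c t.ar.symm
  have sp' : s ≠ p' := by
    rintro rfl; exact nc.c4 t.ap h1c t.rs.symm t.ar.symm (by grind) (by grind)
  have sB : s ∉ [a, m, p, b, q, m', p'].toFinset := by
    simp only [List.mem_toFinset, List.mem_cons, List.not_mem_nil, or_false, not_or]; grind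
  have rB : r ∉ [a, m, p, b, q, m', p'].toFinset := by
    simp only [List.mem_toFinset, List.mem_cons, List.not_mem_nil, or_false, not_or]; grind
  have hs' : s' = p' := by
    have hI : [a, m, b, m'].toFinset ⊆
        [a, m, p, b, q, m', p'].toFinset ∩ [b, m, s, a, r, m', s'].toFinset := by
      intro z hz; simp at hz ⊢; grind
    have cI := Finset.card_le_card hI
    have c4 : ([a, m, b, m'].toFinset).card = 4 := by
      rw [List.toFinset_card_of_nodup (by
        simp only [List.nodup_cons, List.mem_cons, List.not_mem_nil, or_false, not_or]; grind)]
      rfl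
    rcases inter7 G h3 hQ hn c1 c2 h1e h2e (by omega) with h | ⟨h5, -, -⟩
    · rw [h] at sB; simp at sB
    · have s'B : s' ∈ [a, m, p, b, q, m', p'].toFinset := by
        by_contra hno
        have : [a, m, p, b, q, m', p'].toFinset ∩ [b, m, s, a, r, m', s'].toFinset ⊆
            [a, m, b, m'].toFinset := by
          intro z hz
          rw [Finset.mem_inter] at hz
          obtain ⟨z1, z2⟩ := hz
          simp only [List.mem_toFinset, List.mem_cons, List.not_mem_nil, or_false] at z2 ⊢
          rcases z2 with rfl | rfl | rfl | rfl | rfl | rfl | rfl <;> first | grind | contradiction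
        have := Finset.card_le_card this
        omega
      simp only [List.mem_toFinset, List.mem_cons, List.not_mem_nil, or_false] at s'B
      rcases s'B with h | h | h | h | h | h | h
      · grind
      · grind
      · subst h; exact (nc.c4 t.ap h2c.symm t.rs.symm t.ar.symm (by grind) (by grind)).elim
      · grind
      · subst h; exact (nc.tri t.qb t.sb.symm h2c).elim
      · grind
      · exact h
  subst hs'
  have s'T : s' ∉ [m, a, b, p, q, r, s].toFinset := by
    simp only [List.mem_toFinset, List.mem_cons, List.not_mem_nil, or_false, not_or]; grind
  have hI : [a, m, b].toFinset ⊆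
      [m, a, b, p, q, r, s].toFinset ∩ [a, m, p, b, q, m', s'].toFinset := by
    intro z hz; simp at hz ⊢; grind
  have cI := Finset.card_le_card hI
  rw [List.toFinset_card_of_nodup (by
    simp only [List.nodup_cons, List.mem_cons, List.not_mem_nil, or_false, not_or]; grind)] at cI
  rcases inter7 G h3 hQ hn t.ca c1 d1 h1e cI with h | ⟨-, -, h0⟩
  · rw [← h] at sB; simp at sB
  · simp only [ee, Finset.sum_eq_zero_iff] at h0
    have := h0 s (Finset.mem_sdiff.2 ⟨by simp, sB⟩) s' (Finset.mem_sdiff.2 ⟨by simp, s'T⟩)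
    simp [h2c] at this

lemma theta_false (h3 : G.IsRegularOfDegree 3) (nc : NC G)
    (hvt : ∀ x y : V, ∃ φ : G ≃g G, φ x = y)
    (hQ : ∀ S : Finset V, 4 ≤ S.card → 4 ≤ Sᶜ.card → 5 ≤ dd G S) (hn : 14 ≤ Fintype.card V)
    {m a b p q r s : V} (t : Theta G m a b p q r s)
    (d1 : dd G [m, a, b, p, q, r, s].toFinset = 5) : False := by
  have d1' := d1
  rw [← sw1] at d1'
  have d1'' := d1
  rw [← sw2] at d1''
  obtain ⟨m', p', h⟩ := step h3 nc hvt hQ hn t d1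
  obtain ⟨m'', q', h'⟩ := step h3 nc hvt hQ hn t.swap2 d1''
  have e : m'' = m' := by
    have nd := t.nd
    simp only [List.nodup_cons, List.mem_cons, List.not_mem_nil, or_false, not_or] at nd
    have x1 : G.Adj m m' ∧ m' ≠ a ∧ m' ≠ b := by
      rcases h with h | h <;> refine ⟨h.1, ?_⟩ <;> have := h.2.2.2.1 <;>
      simp only [List.nodup_cons, List.mem_cons, List.not_mem_nil, or_false, not_or] at this <;>
      grind
    have x2 : G.Adj m m'' ∧ m'' ≠ a ∧ m'' ≠ b := by
      rcases h' with h | h <;> refine ⟨h.1, ?_⟩ <;> have := h.2.2.2.1 <;>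
      simp only [List.nodup_cons, List.mem_cons, List.not_mem_nil, or_false, not_or] at this <;>
      grind
    rcases all3 G h3 t.ma t.mb x1.1 (by grind) x1.2.1.symm x1.2.2.symm m'' x2.1 with h | h | h
    · exact absurd h x2.2.1
    · exact absurd h x2.2.2
    · exact h
  subst e
  rcases h with h | h <;> rcases h' with h' | h'
  · exact fin1 h3 nc hQ hn t h h'
  · exact fin2 h3 nc hQ hn t d1 h h'
  · exact fin2 h3 nc hQ hn t.swap1 d1' h h'
  · exact fin1 h3 nc hQ hn t.swap1 h h'

end CG
namespace CG
variable {V : Type*} [Fintype V] [DecidableEq V] {G : SimpleGraph V} [DecidableRel G.Adj]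

lemma core (hc : G.Connected) (h3 : G.IsRegularOfDegree 3) (nc : NC G)
    (hvt : ∀ x y : V, ∃ φ : G ≃g G, φ x = y) {k : ℕ} (hk : k ≤ 5) (Cyc : Finset V → Prop)
    (f1 : ∀ S, Cyc S → 5 ≤ S.card) (f2 : ∀ S : Finset V, 0 < S.card → dd G S ≤ S.card + 1 → Cyc S)
    (f3 : ∀ S, Cyc S → Cyc Sᶜ → k ≤ dd G S) {A : Finset V} (hA : Cyc A) (hA' : Cyc Aᶜ)
    (hd : dd G A = k) : k = 5 ∧ (A.card = 5 ∨ Aᶜ.card = 5) := by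
  have ex : ∀ (P : Finset V → Prop), (∃ A, P A) → ∃ A, P A ∧ ∀ B, P B → A.card ≤ B.card := by
    intro P hP
    obtain ⟨A, hA, hm⟩ := exists_minimalFor_of_wellFoundedLT P Finset.card hP
    refine ⟨A, hA, fun B hB => ?_⟩
    rcases le_total A.card B.card with h | h
    · exact h
    · exact hm hB h
  have hQ : ∀ t, k ≤ t + 1 → 0 < t → ∀ S : Finset V, t ≤ S.card → t ≤ Sᶜ.card → k ≤ dd G S := by
    intro t ht h0 S h1 h2
    by_contra hlt
    refine hlt (f3 S (f2 S (by omega) (by omega)) (f2 _ (by omega) ?_))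
    rw [dd_compl]; omega
  have hk5 : k = 5 := by
    by_contra hne
    obtain ⟨A, ⟨hA, hA', hd⟩, hmin⟩ := ex (fun A => Cyc A ∧ Cyc Aᶜ ∧ dd G A = k) ⟨A, hA, hA', hd⟩
    have a1 := f1 _ hA
    have a2 := f1 _ hA'
    have hle : A.card ≤ Aᶜ.card := hmin _ ⟨hA', by rwa [compl_compl], by rw [dd_compl, hd]⟩
    have fam : ∀ S, S ⊆ A → 3 ≤ S.card → dd G S = k → S = A := by
      intro S hS h3 hk
      have c := Finset.card_le_card (Finset.compl_subset_compl.2 hS)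
      exact Finset.eq_of_subset_of_card_le hS (hmin S ⟨f2 _ (by omega) (by omega),
        f2 _ (by omega) (by rw [dd_compl]; omega), hk⟩)
    have hb : ∀ φ : G ≃g G, A ∩ A.image φ = ∅ ∨ A ∩ A.image φ = A := by
      intro φ
      obtain ⟨u1, u2⟩ := uncross_t G (hQ 3 (by omega) (by omega)) hd
        (by rw [dd_image, hd] : dd G (A.image φ) = k) (card_image G φ A).symm hle
      by_cases h : 3 ≤ (A ∩ A.image φ).card
      · exact Or.inr (fam _ Finset.inter_subset_left h (u1 h).1)
      · have c1 := Finset.card_inter_add_card_sdiff A (A.image φ)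
        have h' : 3 ≤ (A \ A.image φ).card := by omega
        have := fam _ Finset.sdiff_subset h' (u2 h')
        rw [this] at c1
        exact Or.inl (Finset.card_eq_zero.1 (by omega))
    obtain ⟨c, hcc⟩ := block G hvt (Finset.card_pos.1 (by omega)) hb
    have hp := dd_pos G hc (A := A) (Finset.card_pos.1 (by omega)) (Finset.card_pos.1 (by omega))
    rcases Nat.eq_zero_or_pos c with rfl | h0
    · simp at hcc; exact hp hcc
    · have := Nat.le_mul_of_pos_right A.card h0
      omega
  refine ⟨hk5, ?_⟩
  subst hk5
  by_contra hno
  rw [not_or] at hno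
  have b1 := f1 _ hA
  have b2 := f1 _ hA'
  have b3 := dd_parity G h3 A
  have b4 := dd_parity G h3 Aᶜ
  rw [dd_compl] at b4
  obtain ⟨A, ⟨a1, a2, hd⟩, hmin⟩ := ex (fun A => 7 ≤ A.card ∧ 7 ≤ Aᶜ.card ∧ dd G A = 5)
    ⟨A, by omega, by omega, hd⟩
  have hQ4 := hQ 4 (by omega) (by omega)
  have hle : A.card ≤ Aᶜ.card := hmin _ ⟨a2, by rwa [compl_compl], by rw [dd_compl, hd]⟩
  have pA := dd_parity G h3 A
  have cA := Finset.card_compl_add_card A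
  have fam : ∀ S, S ⊆ A → 4 ≤ S.card → dd G S = 5 → S.card = 5 ∨ S = A := by
    intro S hS h4 hk
    have p := dd_parity G h3 S
    by_cases h5 : S.card = 5
    · exact Or.inl h5
    · have c := Finset.card_le_card (Finset.compl_subset_compl.2 hS)
      exact Or.inr (Finset.eq_of_subset_of_card_le hS (hmin S ⟨by omega, by omega, hk⟩))
  have noP : ∀ P, P ⊆ A → A.card = 7 → P.card = 5 → dd G P = 5 → False := by
    intro P hP h7 h5 hd5
    have cP := Finset.card_compl_add_card P
    obtain ⟨m, a, b, p, q, r, s, t, ht⟩ := mk_theta G nc hP h7 h5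
      (fun x hx => two_nb G h3 hQ4 (by omega) (by omega) hd5 hx)
      (fun x hx => two_nb G h3 hQ4 (by omega) (by omega) hd hx)
    exact theta_false h3 nc hvt hQ4 (by omega) t (by rw [ht, hd])
  have hb : ∀ φ : G ≃g G, A ∩ A.image φ = ∅ ∨ A ∩ A.image φ = A := by
    intro φ
    obtain ⟨u1, u2⟩ := uncross_t G hQ4 hd
      (by rw [dd_image, hd] : dd G (A.image φ) = 5) (card_image G φ A).symm hle
    have c1 := Finset.card_inter_add_card_sdiff A (A.image φ)
    have p1 := dd_parity G h3 (A ∩ A.image φ)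
    have p2 := dd_parity G h3 (A \ A.image φ)
    by_cases h : 4 ≤ (A ∩ A.image φ).card
    · rcases fam _ Finset.inter_subset_left h (u1 h).1 with h5 | h5
      · exact (noP _ Finset.inter_subset_left (by omega) h5 (u1 h).1).elim
      · exact Or.inr h5
    · have h' : 4 ≤ (A \ A.image φ).card := by omega
      rcases fam _ Finset.sdiff_subset h' (u2 h') with h5 | h5
      · exact (noP _ Finset.sdiff_subset (by omega) h5 (u2 h')).elim
      · rw [h5] at c1
        exact Or.inl (Finset.card_eq_zero.1 (by omega))
  obtain ⟨c, hcc⟩ := block G hvt (Finset.card_pos.1 (by omega)) hb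
  rcases Nat.eq_zero_or_pos c with rfl | h0
  · omega
  · have := Nat.le_mul_of_pos_right A.card h0
    omega

end CG
namespace CG
variable {V : Type*} [Fintype V] [DecidableEq V] {G : SimpleGraph V} [DecidableRel G.Adj]

def Cyc (G : SimpleGraph V) (S : Finset V) : Prop :=
  ∃ (u : V) (c : G.Walk u u), c.IsCycle ∧ ∀ x ∈ c.support, x ∈ S

def bdry (G : SimpleGraph V) [DecidableRel G.Adj] (S : Finset V) : Finset (Sym2 V) :=
  ((S ×ˢ Sᶜ).filter (fun p => G.Adj p.1 p.2)).image (fun p => s(p.1, p.2))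

lemma mem_bdry {S : Finset V} {x y : V} (hx : x ∈ S) (hy : y ∉ S) (h : G.Adj x y) :
    s(x, y) ∈ bdry G S := by
  simp only [bdry, Finset.mem_image, Finset.mem_filter, Finset.mem_product, Finset.mem_compl]
  exact ⟨(x, y), ⟨⟨hx, hy⟩, h⟩, rfl⟩

lemma of_mem_bdry {S : Finset V} {e : Sym2 V} (he : e ∈ bdry G S) :
    ∃ x y, x ∈ S ∧ y ∉ S ∧ G.Adj x y ∧ e = s(x, y) := by
  simp only [bdry, Finset.mem_image, Finset.mem_filter, Finset.mem_product, Finset.mem_compl] at he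
  obtain ⟨⟨x, y⟩, ⟨⟨hx, hy⟩, h⟩, rfl⟩ := he
  exact ⟨x, y, hx, hy, h, rfl⟩

lemma card_bdry (S : Finset V) : (bdry G S).card = dd G S := by
  unfold bdry
  rw [Finset.card_image_of_injOn]
  · rw [Finset.card_filter, Finset.sum_product]; rfl
  · rintro ⟨x, y⟩ h ⟨x', y'⟩ h' he
    simp at h h' he
    rcases he with ⟨rfl, rfl⟩ | ⟨rfl, rfl⟩
    · rfl
    · exact absurd h.1.1 h'.1.2

lemma len_le {u : V} {H : SimpleGraph V} {c : H.Walk u u} (hc : c.IsCycle) {S : Finset V}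
    (h : ∀ x ∈ c.support, x ∈ S) : c.length = c.support.tail.toFinset.card ∧
      c.support.tail.toFinset ⊆ S := by
  constructor
  · rw [List.toFinset_card_of_nodup hc.support_nodup]; simp
  · intro x hx
    exact h x (List.mem_of_mem_tail (List.mem_toFinset.1 hx))

lemma f1 (hg : G.girth = 5) (S : Finset V) (h : Cyc G S) : 5 ≤ S.card := by
  obtain ⟨u, c, hc, hs⟩ := h
  obtain ⟨h1, h2⟩ := len_le hc hs
  have := girth_le_length hc
  have := Finset.card_le_card h2
  omega

lemma f2 (h3 : G.IsRegularOfDegree 3) (S : Finset V) (h0 : 0 < S.card)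
    (hd : dd G S ≤ S.card + 1) : Cyc G S := by
  by_contra hno
  have hac : (G.induce (S : Set V)).IsAcyclic := by
    intro u c hc
    refine hno ⟨_, c.map (Embedding.induce (S : Set V)).toHom,
      hc.map (Embedding.induce (G := G) (S : Set V)).injective, ?_⟩
    intro x hx
    rw [Walk.support_map, List.mem_map] at hx
    obtain ⟨y, -, rfl⟩ := hx
    exact y.2
  obtain ⟨x0, hx0⟩ := Finset.card_pos.1 h0
  have : Nonempty (S : Set V) := ⟨⟨x0, hx0⟩⟩
  obtain ⟨T, hT, -, hTt⟩ := (connected_top (V := (S : Set V))).exists_isTree_le_of_le_of_isAcyclic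
    le_top hac
  classical
  have e1 := hTt.card_edgeFinset
  have e2 : (G.induce (S : Set V)).edgeFinset.card ≤ T.edgeFinset.card :=
    Finset.card_le_card (edgeFinset_mono hT)
  have e3 := (G.induce (S : Set V)).sum_degrees_eq_twice_card_edges
  have e4 : Fintype.card (S : Set V) = S.card := by simp
  have e5 : ∑ v, (G.induce (S : Set V)).degree v = ee G S S := by
    unfold ee
    rw [← Finset.sum_coe_sort S]
    refine Finset.sum_congr rfl fun v _ => ?_
    rw [← Finset.sum_coe_sort S, ← card_neighborFinset_eq_degree, neighborFinset_eq_filter,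
      Finset.card_filter]
    rfl
  have := dd_add G h3 S
  omega

lemma noreach {F : Set (Sym2 V)} {S : Finset V} (hF : (bdry G S : Set (Sym2 V)) ⊆ F) {x y : V}
    (hx : x ∈ S) (h : (G.deleteEdges F).Reachable x y) : y ∈ S := by
  obtain ⟨w⟩ := h
  induction w with
  | nil => exact hx
  | cons h p ih =>
    apply ih
    by_contra hv
    rw [deleteEdges_adj] at h
    exact h.2 (hF (mem_bdry hx hv h.1))

lemma cyc_del {S : Finset V} (h : Cyc G S) {F : Set (Sym2 V)}
    (hF : ∀ e ∈ F, ∃ x ∈ e, x ∉ S) :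
    ∃ (u : V) (c : (G.deleteEdges F).Walk u u), c.IsCycle ∧ u ∈ S := by
  obtain ⟨u, c, hc, hs⟩ := h
  have he : ∀ e ∈ c.edges, e ∈ (G.deleteEdges F).edgeSet := by
    intro e he
    rw [edgeSet_deleteEdges]
    refine ⟨c.edges_subset_edgeSet he, fun hf => ?_⟩
    obtain ⟨x, hx, hxS⟩ := hF e hf
    exact hxS (hs x (c.mem_support_of_mem_edges he hx))
  exact ⟨u, c.transfer _ he, hc.transfer he, hs u c.start_mem_support⟩

lemma cut {S : Finset V} (h : Cyc G S) (h' : Cyc G Sᶜ) :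
    G.edgeSet ⊇ (bdry G S : Set (Sym2 V)) ∧
    ∃ (u v : V) (c : (G.deleteEdges (bdry G S : Set (Sym2 V))).Walk u u)
      (c' : (G.deleteEdges (bdry G S : Set (Sym2 V))).Walk v v),
      c.IsCycle ∧ c'.IsCycle ∧ ¬ (G.deleteEdges (bdry G S : Set (Sym2 V))).Reachable u v := by
  constructor
  · intro e he
    obtain ⟨x, y, -, -, h, rfl⟩ := of_mem_bdry he
    exact h
  · obtain ⟨u, c, hc, hu⟩ := cyc_del h (F := (bdry G S : Set (Sym2 V))) (by
      intro e he
      obtain ⟨x, y, hx, hy, h, rfl⟩ := of_mem_bdry he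
      exact ⟨y, by simp, hy⟩)
    obtain ⟨v, c', hc', hv⟩ := cyc_del h' (F := (bdry G S : Set (Sym2 V))) (by
      intro e he
      obtain ⟨x, y, hx, hy, h, rfl⟩ := of_mem_bdry he
      exact ⟨x, by simp, by simpa using hx⟩)
    refine ⟨u, v, c, c', hc, hc', fun hr => ?_⟩
    have := noreach subset_rfl hu hr
    simp at hv; exact hv this

lemma deg2 {H : SimpleGraph V} (hH : H ≤ G) {u : V} {c : H.Walk u u} (hc : c.IsCycle)
    {S : Finset V} (h : ∀ x ∈ c.support, x ∈ S) {x : V} (hx : x ∈ c.support) :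
    c.toSubgraph.neighborSet x ⊆ (S.filter (G.Adj x) : Finset V) ∧
      2 ≤ (S.filter (G.Adj x)).card := by
  have h1 : c.toSubgraph.neighborSet x ⊆ (S.filter (G.Adj x) : Finset V) := by
    intro y hy
    rw [Subgraph.mem_neighborSet] at hy
    have hyS : y ∈ c.support := by
      have := c.toSubgraph.edge_vert hy.symm
      simpa using this
    simp only [Finset.coe_filter, Set.mem_ofPred_eq]
    exact ⟨h y hyS, hH hy.adj_sub⟩
  refine ⟨h1, ?_⟩
  have h2 := hc.ncard_neighborSet_toSubgraph_eq_two hx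
  rw [← h2, ← Set.ncard_coe_finset]
  exact Set.ncard_le_ncard h1 (Finset.finite_toSet _)

lemma ee_eq (S : Finset V) : ee G S S = ∑ x ∈ S, (S.filter (G.Adj x)).card := by
  unfold ee
  refine Finset.sum_congr rfl fun x _ => ?_
  rw [Finset.card_filter]

lemma girth_nc (hg : G.girth = 5) : NC G := by
  constructor
  · intro a b c h1 h2 h3
    have hc : (Walk.cons h1 (Walk.cons h2 (Walk.cons h3 Walk.nil))).IsCycle := by
      rw [Walk.cons_isCycle_iff]
      have := h1.ne; have := h2.ne; have := h3.ne
      simp [Walk.cons_isPath_iff]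
      grind
    have := girth_le_length hc
    simp at this; omega
  · intro a b c d h1 h2 h3 h4 hac hbd
    have hc : (Walk.cons h1 (Walk.cons h2 (Walk.cons h3 (Walk.cons h4 Walk.nil)))).IsCycle := by
      rw [Walk.cons_isCycle_iff]
      have := h1.ne; have := h2.ne; have := h3.ne; have := h4.ne
      simp [Walk.cons_isPath_iff]
      grind
    have := girth_le_length hc
    simp at this; omega

lemma finish (h3 : G.IsRegularOfDegree 3) (hg : G.girth = 5) {H : SimpleGraph V} (hH : H ≤ G)
    {S : Finset V} (h5 : S.card = 5) (hd : dd G S = 5) {u : V} (c : H.Walk u u) (hc : c.IsCycle)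
    (hS : ∀ x, H.Reachable u x → x ∈ S) :
    c.length = 5 ∧ (∀ w, H.Reachable u w → w ∈ c.support) ∧
    (∀ e ∈ H.edgeSet, (∃ w, w ∈ e ∧ H.Reachable u w) → e ∈ c.edges) := by
  have hs : ∀ x ∈ c.support, x ∈ S := fun x hx => hS x ⟨c.takeUntil x hx⟩
  obtain ⟨l1, l2⟩ := len_le hc hs
  have l3 := Finset.card_le_card l2
  have l4 : 5 ≤ c.length := by
    have := girth_le_length (hc.mapLe hH)
    rw [hg] at this; simpa using this
  have l5 := Finset.eq_of_subset_of_card_le l2 (by omega)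
  have hsup : ∀ w ∈ S, w ∈ c.support := by
    intro w hw
    rw [← l5] at hw
    exact List.mem_of_mem_tail (List.mem_toFinset.1 hw)
  refine ⟨by omega, fun w hw => hsup w (hS w hw), ?_⟩
  have heq : ∀ x ∈ S, (S.filter (G.Adj x)).card = 2 := by
    have a := dd_add G h3 S
    rw [ee_eq] at a
    have e : ∑ x ∈ S, 2 = ∑ x ∈ S, (S.filter (G.Adj x)).card := by
      simp [h5]; omega
    have := (Finset.sum_eq_sum_iff_of_le (fun x hx => (deg2 hH hc hs (hsup x hx)).2)).1 e
    intro x hx; exact (this x hx).symm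
  have key : ∀ x y, x ∈ S → y ∈ S → H.Adj x y → s(x, y) ∈ c.edges := by
    intro x y hx hy hxy
    have h1 := (deg2 hH hc hs (hsup x hx)).1
    have h2 := hc.ncard_neighborSet_toSubgraph_eq_two (hsup x hx)
    have h4 := Set.eq_of_subset_of_ncard_le h1
      (by rw [h2, Set.ncard_coe_finset, heq x hx]) (Finset.finite_toSet _)
    have : y ∈ c.toSubgraph.neighborSet x := by
      rw [h4]; simp [hy, hH hxy]
    rw [Subgraph.mem_neighborSet] at this
    exact c.adj_toSubgraph_iff_mem_edges.1 this
  intro e he hw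
  induction e with | _ x y
  obtain ⟨w, hw, hr⟩ := hw
  have hxy : H.Adj x y := he
  simp at hw
  rcases hw with rfl | rfl
  · exact key _ _ (hS _ hr) (hS _ (hr.trans hxy.reachable)) hxy
  · exact key _ _ (hS _ (hr.trans hxy.symm.reachable)) (hS _ hr) hxy

lemma five (h3 : G.IsRegularOfDegree 3) (hg : G.girth = 5) (hn : 10 ≤ Fintype.card V) :
    ∃ S, Cyc G S ∧ Cyc G Sᶜ ∧ dd G S ≤ 5 := by
  have hna : ¬ G.IsAcyclic := by
    intro h; rw [← girth_eq_zero] at h; omega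
  obtain ⟨u, c, hc, hl⟩ := exists_girth_eq_length.2 hna
  have hs : ∀ x ∈ c.support, x ∈ c.support.toFinset := fun x hx => List.mem_toFinset.2 hx
  have hss : c.support.tail.toFinset = c.support.toFinset := by
    apply Finset.Subset.antisymm (len_le hc hs).2
    intro x hx
    rw [List.mem_toFinset] at hx ⊢
    have hnn : ¬ c.Nil := hc.not_nil
    rw [Walk.mem_support_iff] at hx
    rcases hx with rfl | hx
    · exact c.end_mem_tail_support hnn
    · exact hx
  have h5 : c.support.toFinset.card = 5 := by
    rw [← hss, ← (len_le hc hs).1, ← hl, hg]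
  have hd : dd G c.support.toFinset ≤ 5 := by
    have a := dd_add G h3 c.support.toFinset
    rw [ee_eq] at a
    have := Finset.sum_le_sum (f := fun _ => 2)
      (fun x (hx : x ∈ c.support.toFinset) => (deg2 le_rfl hc hs (List.mem_toFinset.1 hx)).2)
    simp only [Finset.sum_const, smul_eq_mul, h5] at this
    omega
  have cc := Finset.card_compl_add_card c.support.toFinset
  exact ⟨_, ⟨u, c, hc, hs⟩, f2 h3 _ (by omega) (by rw [dd_compl]; omega), hd⟩

end CG
/-- A finite connected cubic vertex-transitive graph of girth 5 is super cyclically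
edge-connected: the removal of any minimum cyclic edge-cut leaves a component which is
a cycle of length 5. -/
theorem cubic_girth_five_super_cyclically_edge_connected {V : Type*} [Fintype V]
    (G : SimpleGraph V) [DecidableRel G.Adj] (hconn : G.Connected)
    (hcubic : G.IsRegularOfDegree 3) (hvt : IsVertexTransitive G) (hg : G.girth = 5) :
    ∀ F : Set (Sym2 V), IsCyclicEdgeCut G F →
      (∀ F', IsCyclicEdgeCut G F' → F.ncard ≤ F'.ncard) →
      HasCycleComponentOfLength (G.deleteEdges F) 5 := by
  classical
  intro F hF hmin
  obtain ⟨hFG, u, v, c, c', hc, hc', hr⟩ := hF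
  have hle : G.deleteEdges F ≤ G := deleteEdges_le F
  have f3 : ∀ S, CG.Cyc G S → CG.Cyc G Sᶜ → F.ncard ≤ CG.dd G S := by
    intro S h1 h2
    have := hmin _ (CG.cut h1 h2)
    rwa [Set.ncard_coe_finset, CG.card_bdry] at this
  let A : Finset V := Finset.univ.filter (fun x => (G.deleteEdges F).Reachable u x)
  have mA : ∀ x, x ∈ A ↔ (G.deleteEdges F).Reachable u x := by intro x; simp [A]
  have mAc : ∀ x, (G.deleteEdges F).Reachable v x → x ∈ Aᶜ := by
    intro x hx
    rw [Finset.mem_compl, mA]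
    exact fun h => hr (h.trans hx.symm)
  have cA : CG.Cyc G A := ⟨u, c.mapLe hle, hc.mapLe hle, by
    intro x hx; simp at hx; exact (mA x).2 ⟨c.takeUntil x hx⟩⟩
  have cA' : CG.Cyc G Aᶜ := ⟨v, c'.mapLe hle, hc'.mapLe hle, by
    intro x hx; simp only [Walk.support_mapLe_eq_support] at hx; exact mAc x ⟨c'.takeUntil x hx⟩⟩
  have hb : (CG.bdry G A : Set (Sym2 V)) ⊆ F := by
    intro e he
    obtain ⟨x, y, hx, hy, h, rfl⟩ := CG.of_mem_bdry he
    by_contra hno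
    apply hy
    rw [mA] at hx ⊢
    exact hx.trans (Adj.reachable (by rw [deleteEdges_adj]; exact ⟨h, hno⟩))
  have hd : CG.dd G A = F.ncard := by
    apply le_antisymm _ (f3 A cA cA')
    rw [← CG.card_bdry, ← Set.ncard_coe_finset]
    exact Set.ncard_le_ncard hb (Set.toFinite F)
  have n1 := CG.f1 hg _ cA
  have n2 := CG.f1 hg _ cA'
  have n3 := Finset.card_compl_add_card A
  obtain ⟨S, s1, s2, s3⟩ := CG.five hcubic hg (by omega)
  have hk : F.ncard ≤ 5 := (f3 S s1 s2).trans s3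
  obtain ⟨k5, h | h⟩ := CG.core hconn hcubic (CG.girth_nc hg) hvt hk (CG.Cyc G) (CG.f1 hg)
    (CG.f2 hcubic) f3 cA cA' hd
  · exact ⟨u, c, hc, CG.finish hcubic hg hle h (by omega) c hc (fun x hx => (mA x).2 hx)⟩
  · exact ⟨v, c', hc', CG.finish hcubic hg hle h (by rw [CG.dd_compl]; omega) c' hc' mAc⟩
end
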